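/- arXiv:1303.2302 — 4 statements merged into one kernel-verified Lean document; each statement's English description precedes it below -/
import Mathlib

section
/- For every natural number n, d_n^B(x) = Σ (n choose r_0, r_1, …, r_k) · x^{⌊(k+1)/2⌋} · d_{r_0}(x) · A_{r_1}(x) ⋯ A_{r_k}(x), where the sum ranges over all k ∈ ℕ and all sequences (r_0, r_1, …, r_k) of nonnegative integers with r_0 + r_1 + ⋯ + r_k = n and r_i ≥ 1 for 1 ≤ i ≤ k (equivalently, over all sequences of nonnegative integers summing to n, with the convention A_0(x) = 0), and (n choose r_0, …, r_k) = n!/(r_0! r_1! ⋯ r_k!) is the multinomial coefficient. -/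
open Polynomial Finset

/-- A signed permutation of `[n]`, encoded by its word: position `i` (0-indexed)
holds the pair (absolute value minus one, sign) of the letter `w(a_{i+1})`. -/
def IsSP {n : ℕ} (u : Fin n → Fin n × Bool) : Prop :=
  Function.Bijective fun i => (u i).1

instance {n : ℕ} (u : Fin n → Fin n × Bool) : Decidable (IsSP u) :=
  inferInstanceAs (Decidable (Function.Bijective _))

/-- the letter `w(a_{i+1})` at position `i` of the word -/
def letterW {n : ℕ} (u : Fin n → Fin n × Bool) (i : Fin n) : ℤ :=
  if (u i).2 then ((u i).1 : ℤ) + 1 else -(((u i).1 : ℤ) + 1)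

/-- `a_{k+1}`: the element of the domain `S` with absolute value `k+1` -/
def aVal {n : ℕ} (u : Fin n → Fin n × Bool) (k : Fin n) : ℤ :=
  if ∃ j, u j = (k, true) then ((k : ℤ) + 1) else -((k : ℤ) + 1)

/-- the number of type `B` excedances -/
def excB {n : ℕ} (u : Fin n → Fin n × Bool) : ℕ :=
  (univ.filter fun k : Fin n =>
    aVal u k < letterW u k ∨ (aVal u k < 0 ∧ letterW u k = aVal u k)).card

/-- a derangement: no positive fixed point -/
def IsDerB {n : ℕ} (u : Fin n → Fin n × Bool) : Prop :=
  ∀ k : Fin n, 0 < aVal u k → letterW u k ≠ aVal u k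

instance {n : ℕ} (u : Fin n → Fin n × Bool) : Decidable (IsDerB u) := by
  unfold IsDerB; infer_instance

/-- the type `B` derangement polynomial -/
noncomputable def dB (n : ℕ) : Polynomial ℝ :=
  ∑ u ∈ univ.filter (fun u : Fin n → Fin n × Bool => IsSP u ∧ IsDerB u), X ^ excB u

/-- the number of type `B` descents -/
def desB {n : ℕ} (u : Fin n → Fin n × Bool) : ℕ :=
  (univ.filter fun i : Fin n =>
    ((i : ℕ) = 0 ∧ letterW u i < 0) ∨
    (0 < (i : ℕ) ∧ letterW u i < letterW u ⟨(i : ℕ) - 1, by have := i.isLt; omega⟩)).card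

/-- the type `B` Eulerian polynomial -/
noncomputable def Bpoly (n : ℕ) : Polynomial ℝ :=
  ∑ u ∈ univ.filter (fun u : Fin n → Fin n × Bool => IsSP u), X ^ desB u

/-- the "positive half" type `B` Eulerian polynomial -/
noncomputable def Bplus : ℕ → Polynomial ℝ
  | 0 => 1
  | n + 1 =>
    ∑ u ∈ univ.filter (fun u : Fin (n + 1) → Fin (n + 1) × Bool =>
        IsSP u ∧ 0 < letterW u (Fin.last n)), X ^ desB u

/-- the "negative half" type `B` Eulerian polynomial -/
noncomputable def Bminus : ℕ → Polynomial ℝ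
  | 0 => 0
  | n + 1 =>
    ∑ u ∈ univ.filter (fun u : Fin (n + 1) → Fin (n + 1) × Bool =>
        IsSP u ∧ letterW u (Fin.last n) < 0), X ^ desB u

/-- the number of excedances of a permutation -/
def excA {n : ℕ} (w : Equiv.Perm (Fin n)) : ℕ :=
  (univ.filter fun i : Fin n => i < w i).card

/-- the number of descents of a permutation -/
def desA {n : ℕ} (w : Equiv.Perm (Fin n)) : ℕ :=
  (univ.filter fun i : Fin n =>
    (i : ℕ) + 1 < n ∧ w ⟨((i : ℕ) + 1) % n, Nat.mod_lt _ i.pos⟩ < w i).card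

/-- the (type `A`) derangement polynomial -/
noncomputable def dA (n : ℕ) : Polynomial ℝ :=
  ∑ w ∈ univ.filter (fun w : Equiv.Perm (Fin n) => ∀ i, w i ≠ i), X ^ excA w

/-- the Eulerian polynomial, with the convention `A_0 = 0` -/
noncomputable def Apoly (n : ℕ) : Polynomial ℝ :=
  if n = 0 then 0 else ∑ w : Equiv.Perm (Fin n), X ^ desA w


/-- the Eulerian step operator -/
noncomputable def eulStep (n : ℕ) (p : Polynomial ℝ) : Polynomial ℝ :=
  (1 + (n : Polynomial ℝ) * X) * p + X * (1 - X) * derivative p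

lemma eulStep_sum {ι : Type*} (s : Finset ι) (n : ℕ) (f : ι → Polynomial ℝ) :
    eulStep n (∑ i ∈ s, f i) = ∑ i ∈ s, eulStep n (f i) := by
  simp only [eulStep, derivative_sum, mul_sum, sum_add_distrib]

lemma eulStep_pow (n k : ℕ) : eulStep n (X ^ k) =
    ((k : Polynomial ℝ) + 1) * X ^ k + ((n : Polynomial ℝ) - (k : Polynomial ℝ)) * X ^ (k + 1) := by
  rcases k with _ | k
  · simp [eulStep]
  · simp only [eulStep, derivative_X_pow]
    simp
    ring

lemma sum_pow_indicator {ι : Type*} (s : Finset ι) (P : ι → Prop) [DecidablePred P] (k : ℕ) 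
    (g : ι → ℕ) (hg : ∀ i ∈ s, g i + (if P i then 1 else 0) = k + 1) :
    ∑ i ∈ s, (X : Polynomial ℝ) ^ g i =
      ((s.filter P).card : Polynomial ℝ) * X ^ k +
       ((s.card : Polynomial ℝ) - ((s.filter P).card : Polynomial ℝ)) * X ^ (k + 1) := by
  have h1 : ∀ i ∈ s, (X : Polynomial ℝ) ^ g i =
      (if P i then (1 : Polynomial ℝ) else 0) * (X ^ k - X ^ (k + 1)) + X ^ (k + 1) := by
    intro i hi
    have := hg i hi
    split_ifs at this ⊢ with h
    · have : g i = k := by omega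
      rw [this]; ring
    · have : g i = k + 1 := by omega
      rw [this]; ring
  rw [sum_congr rfl h1, sum_add_distrib, ← sum_mul, sum_boole, sum_const, nsmul_eq_mul]
  ring

lemma exc_insert_zero {n : ℕ} (e : Equiv.Perm (Fin n)) :
    excA (Equiv.Perm.decomposeFin.symm (0, e)) = excA e := by
  unfold excA
  rw [card_filter, card_filter, Fin.sum_univ_succ]
  simp [Equiv.Perm.decomposeFin_symm_apply_succ, -sum_boole]

lemma exc_insert_succ {n : ℕ} (e : Equiv.Perm (Fin n)) (j : Fin n) :
    excA (Equiv.Perm.decomposeFin.symm ((e j).succ, e)) + (if j < e j then 1 else 0)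
      = excA e + 1 := by
  have h : ∀ x : Fin n, (if x.succ < Equiv.Perm.decomposeFin.symm ((e j).succ, e) x.succ
      then 1 else 0) + (if x = j then (if x < e x then 1 else 0) else 0) =
      if x < e x then 1 else 0 := by
    intro x
    rw [Equiv.Perm.decomposeFin_symm_apply_succ]
    by_cases hx : x = j
    · subst hx; simp
    · rw [Equiv.swap_apply_of_ne_of_ne (Fin.succ_ne_zero _) (by simpa using hx)]
      simp [hx]
  have h2 := Finset.sum_congr (rfl : (univ : Finset (Fin n)) = univ) (fun x _ => h x)
  rw [sum_add_distrib, Finset.sum_ite_eq' univ j] at h2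
  simp only [excA, card_filter, Fin.sum_univ_succ, ← h2, mem_univ, if_true]
  simp
  ring

noncomputable def excPoly (n : ℕ) : Polynomial ℝ := ∑ w : Equiv.Perm (Fin n), X ^ excA w

lemma excPoly_succ (n : ℕ) : excPoly (n + 1) = eulStep n (excPoly n) := by
  unfold excPoly
  rw [eulStep_sum, ← Equiv.sum_comp Equiv.Perm.decomposeFin.symm, Fintype.sum_prod_type,
    sum_comm]
  refine sum_congr rfl fun e _ => ?_
  rw [Fin.sum_univ_succ, exc_insert_zero, eulStep_pow, ← Equiv.sum_comp e,
    sum_pow_indicator univ (fun j => j < e j) (excA e) _ (fun j _ => exc_insert_succ e j)]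
  simp only [card_univ, Fintype.card_fin]
  change _ + (((excA e : ℕ) : Polynomial ℝ) * _ + (_ - ((excA e : ℕ) : Polynomial ℝ)) * _) = _
  ring

/-- insertion in a word -/
def insW (E : ℕ → ℕ) (M p i : ℕ) : ℕ := if i < p then E i else if i = p then M else E (i - 1)

lemma insW_last (E : ℕ → ℕ) (M m : ℕ) (hE : ∀ i, E i < M) :
    (∑ i ∈ range (m + 1), if insW E M (m + 1) (i + 1) < insW E M (m + 1) i then 1 else 0) =
    ∑ i ∈ range m, if E (i + 1) < E i then 1 else 0 := by
  rw [sum_range_succ]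
  have : ¬ (insW E M (m + 1) (m + 1) < insW E M (m + 1) m) := by
    have := hE m
    simp [insW]; omega
  rw [if_neg this, add_zero]
  refine sum_congr rfl fun i hi => ?_
  have := mem_range.1 hi
  simp [insW, this, show i < m + 1 by omega]

lemma insW_mid (E : ℕ → ℕ) (M p m : ℕ) (hp : p ≤ m) (hE : ∀ i, E i < M) :
    (∑ i ∈ range (m + 1), if insW E M p (i + 1) < insW E M p i then 1 else 0) +
      (if 0 < p ∧ E p < E (p - 1) then 1 else 0) =
    (∑ i ∈ range m, if E (i + 1) < E i then 1 else 0) + 1 := by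
  induction m, hp using Nat.le_induction with
  | base =>
    rw [sum_range_succ]
    have h1 : insW E M p (p + 1) < insW E M p p := by
      have := hE p
      simpa [insW] using this
    rw [if_pos h1]
    rcases p with _ | q
    · simp
    · rw [insW_last E M q hE, sum_range_succ _ q]
      simp
      ring
  | succ m hm ih =>
    rw [sum_range_succ _ (m + 1), Finset.sum_range_succ (fun i => if E (i + 1) < E i then 1 else 0) m]
    have : insW E M p (m + 1 + 1) = E (m + 1) := by
      simp [insW]; grind
    have h2 : insW E M p (m + 1) = E m := by
      simp [insW]; grind
    rw [this, h2]
    linarith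

/-- natural-number word of a permutation -/
def natW {n : ℕ} (w : Equiv.Perm (Fin n)) (i : ℕ) : ℕ := if h : i < n then w ⟨i, h⟩ else 0

lemma desA_eq {m : ℕ} (w : Equiv.Perm (Fin (m + 1))) :
    desA w = ∑ i ∈ range m, if natW w (i + 1) < natW w i then 1 else 0 := by
  unfold desA
  rw [card_filter, Fin.sum_univ_castSucc, ← Fin.sum_univ_eq_sum_range
    (fun i => if natW w (i + 1) < natW w i then 1 else 0)]
  simp only [Fin.val_last, lt_irrefl, false_and, if_false, add_zero]
  refine sum_congr rfl fun i _ => ?_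
  have := i.isLt
  simp only [natW, Fin.val_castSucc, show (i : ℕ) + 1 < m + 1 by omega, 
    show (i : ℕ) < m + 1 by omega, dif_pos, true_and, Nat.mod_eq_of_lt, Fin.lt_def]
  rfl

/-- insert the maximum at position `p` -/
def insPerm {n : ℕ} (p : Fin (n + 1)) (e : Equiv.Perm (Fin n)) : Equiv.Perm (Fin (n + 1)) :=
  ((finSuccEquiv' p).trans (Equiv.optionCongr e)).trans (finSuccEquiv' (Fin.last n)).symm

lemma insPerm_self {n : ℕ} (p : Fin (n + 1)) (e : Equiv.Perm (Fin n)) :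
    insPerm p e p = Fin.last n := by
  simp [insPerm]

lemma insPerm_succAbove {n : ℕ} (p : Fin (n + 1)) (e : Equiv.Perm (Fin n)) (j : Fin n) :
    insPerm p e (p.succAbove j) = (e j).castSucc := by
  simp [insPerm]

lemma insPerm_bij (n : ℕ) : Function.Bijective
    (fun q : Fin (n + 1) × Equiv.Perm (Fin n) => insPerm q.1 q.2) := by
  rw [Fintype.bijective_iff_injective_and_card]
  constructor
  · rintro ⟨p, e⟩ ⟨p', e'⟩ h
    simp only at h
    have hp : p = p' := by
      apply (insPerm p e).injective
      rw [insPerm_self, h, insPerm_self]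
    subst hp
    congr 1
    ext j
    have := insPerm_succAbove p e j
    rw [h, insPerm_succAbove] at this
    have := Fin.castSucc_injective _ this
    rw [this]
  · simp [Fintype.card_perm, Nat.factorial_succ]

lemma natW_insPerm {n : ℕ} (p : Fin (n + 1)) (e : Equiv.Perm (Fin n)) (i : ℕ) (hi : i < n + 1) :
    natW (insPerm p e) i = insW (natW e) n p i := by
  simp only [natW, hi, dif_pos, insW]
  rcases lt_trichotomy i p with h | h | h
  · have hin : i < n := by have := p.isLt; omega
    have h2 : (⟨i, hi⟩ : Fin (n + 1)) = p.succAbove ⟨i, hin⟩ := by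
      rw [Fin.succAbove_of_castSucc_lt _ _ (by simpa [Fin.lt_def] using h)]
      rfl
    rw [h2, insPerm_succAbove]
    simp [h, hin]
  · have h2 : (⟨i, hi⟩ : Fin (n + 1)) = p := Fin.ext h
    rw [h2, insPerm_self]
    simp [h]
  · have hin : i - 1 < n := by omega
    have h2 : (⟨i, hi⟩ : Fin (n + 1)) = p.succAbove ⟨i - 1, hin⟩ := by
      rw [Fin.succAbove_of_le_castSucc _ _ (by simp [Fin.le_def]; omega)]
      ext; simp; omega
    rw [h2, insPerm_succAbove]
    simp [show ¬ i < p by omega, hin, show i ≠ p by omega]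

lemma natW_lt {n : ℕ} (hn : 0 < n) (e : Equiv.Perm (Fin n)) (i : ℕ) : natW e i < n := by
  unfold natW
  split_ifs
  · exact (e _).isLt
  · exact hn

lemma desA_insPerm {m : ℕ} (p : Fin (m + 2)) (e : Equiv.Perm (Fin (m + 1))) :
    desA (insPerm p e) = ∑ i ∈ range (m + 1),
      if insW (natW e) (m + 1) p (i + 1) < insW (natW e) (m + 1) p i then 1 else 0 := by
  rw [desA_eq]
  refine sum_congr rfl fun i hi => ?_
  have := mem_range.1 hi
  rw [natW_insPerm _ _ _ (by omega), natW_insPerm _ _ _ (by omega)]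

noncomputable def desPoly (n : ℕ) : Polynomial ℝ := ∑ w : Equiv.Perm (Fin n), X ^ desA w

lemma desPoly_succ (m : ℕ) : desPoly (m + 2) = eulStep (m + 1) (desPoly (m + 1)) := by
  unfold desPoly
  rw [eulStep_sum, ← Equiv.sum_comp (Equiv.ofBijective _ (insPerm_bij (m + 1))),
    Fintype.sum_prod_type, sum_comm]
  refine sum_congr rfl fun e _ => ?_
  simp only [Equiv.ofBijective_apply]
  have hE := natW_lt (Nat.succ_pos m) e
  rw [Fin.sum_univ_castSucc, Fin.sum_univ_succ, eulStep_pow]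
  have hlast : desA (insPerm (Fin.last (m + 1)) e) = desA e := by
    rw [desA_insPerm, desA_eq e]
    exact insW_last _ _ _ hE
  have hzero : desA (insPerm (Fin.castSucc (0 : Fin (m + 1))) e) = desA e + 1 := by
    have := insW_mid (natW e) (m + 1) 0 m (Nat.zero_le _) hE
    rw [desA_insPerm, desA_eq e]
    simp only [lt_irrefl, false_and, if_false, add_zero] at this
    exact this
  have hmid : ∀ q : Fin m, desA (insPerm (Fin.castSucc (Fin.succ q)) e) +
      (if natW e (q + 1) < natW e q then 1 else 0) = desA e + 1 := by
    intro q
    have := insW_mid (natW e) (m + 1) (q + 1) m q.isLt hE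
    rw [desA_insPerm, desA_eq e]
    simpa [-sum_boole] using this
  rw [hlast, hzero, sum_pow_indicator univ (fun q : Fin m => natW e (q + 1) < natW e q) (desA e) _ 
    (fun q _ => hmid q)]
  have hc : (univ.filter (fun q : Fin m => natW e (q + 1) < natW e q)).card = desA e := by
    rw [desA_eq, card_filter, ← Fin.sum_univ_eq_sum_range
    (fun i => if natW e (i + 1) < natW e i then 1 else 0)]
  rw [hc]
  simp only [card_univ, Fintype.card_fin]
  push_cast
  ring

lemma desPoly_eq_excPoly (m : ℕ) : desPoly (m + 1) = excPoly (m + 1) := by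
  induction m with
  | zero =>
    simp only [desPoly, excPoly, desA, excA]
    simp
  | succ m ih => rw [desPoly_succ, excPoly_succ, ih]

/-- weak excedances -/
def wexcA {n : ℕ} (w : Equiv.Perm (Fin n)) : ℕ :=
  (univ.filter fun i : Fin n => i ≤ w i).card

lemma wexc_rot {m : ℕ} (w : Equiv.Perm (Fin (m + 1))) :
    wexcA w = excA (w * finRotate (m + 1)) + 1 := by
  unfold wexcA excA
  rw [card_filter, card_filter, Fin.sum_univ_succ, Fin.sum_univ_castSucc]
  simp only [Equiv.Perm.mul_apply, finRotate_last, Fin.zero_le, if_true]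
  have : ¬ (Fin.last m < w 0) := not_lt.2 (Fin.le_last _)
  rw [if_neg this, add_zero, add_comm]
  congr 1
  refine sum_congr rfl fun i _ => ?_
  have h : finRotate (m + 1) i.castSucc = i.succ := by
    simp
  simp only [h, Fin.le_def, Fin.lt_def, Fin.val_succ, Fin.val_castSucc, Nat.succ_le_iff]

lemma wexc_sum (m : ℕ) : ∑ w : Equiv.Perm (Fin (m + 1)), (X : Polynomial ℝ) ^ wexcA w =
    X * excPoly (m + 1) := by
  unfold excPoly
  rw [← Equiv.sum_comp (Equiv.mulRight (finRotate (m + 1))) (fun w => (X : Polynomial ℝ) ^ excA w), mul_sum]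
  refine sum_congr rfl fun w _ => ?_
  rw [wexc_rot, pow_succ, mul_comm]
  rfl

lemma derange_sum {α : Type} [Fintype α] [DecidableEq α] (f : α → ℤ) (hf : Function.Injective f) :
    ∑ w ∈ univ.filter (fun w : Equiv.Perm α => ∀ i, w i ≠ i),
      (X : Polynomial ℝ) ^ (univ.filter fun i => f i < f (w i)).card = dA (Fintype.card α) := by
  obtain ⟨e, he⟩ : ∃ e : Fin (Fintype.card α) ≃ α, ∀ i j, f (e i) < f (e j) ↔ i < j := by
    letI : LinearOrder α := LinearOrder.lift' f hf
    refine ⟨(Fintype.orderIsoFinOfCardEq α rfl).toEquiv, fun i j => ?_⟩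
    exact (Fintype.orderIsoFinOfCardEq α rfl).lt_iff_lt
  unfold dA
  symm
  refine sum_equiv e.permCongr ?_ ?_
  · intro w
    simp only [mem_filter, mem_univ, true_and, Equiv.permCongr_apply]
    rw [← e.forall_congr_right]
    simp
  · intro w _
    congr 1
    unfold excA
    rw [card_filter, card_filter, ← Equiv.sum_comp e]
    simp [Equiv.permCongr_apply, he]

lemma fix_sum {n : ℕ} (f : Fin n → ℤ) (hf : Function.Injective f) (c : Fin n → Polynomial ℝ) :
    ∑ w : Equiv.Perm (Fin n), (X : Polynomial ℝ) ^ (univ.filter fun i => f i < f (w i)).card *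
      ∏ i ∈ univ.filter (fun i => w i = i), c i =
    ∑ F : Finset (Fin n), (∏ i ∈ F, c i) * dA (n - F.card) := by
  rw [← Finset.sum_fiberwise univ (fun w : Equiv.Perm (Fin n) => univ.filter (fun i => w i = i))]
  refine sum_congr rfl fun F _ => ?_
  have h1 : Fintype.card {i : Fin n // i ∉ F} = n - F.card := by
    rw [Fintype.card_subtype_compl]; simp
  rw [← h1, ← derange_sum (fun i : {i : Fin n // i ∉ F} => f i)
    (hf.comp Subtype.val_injective), mul_sum]
  symm
  refine sum_bij (fun w _ => Equiv.Perm.ofSubtype w) ?_ ?_ ?_ ?_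
  · intro w hw
    simp only [mem_filter, mem_univ, true_and] at hw ⊢
    ext i
    simp only [mem_filter, mem_univ, true_and]
    by_cases hi : i ∈ F
    · simp [Equiv.Perm.ofSubtype_apply_of_not_mem w (a := i) (by simpa using hi), hi]
    · rw [Equiv.Perm.ofSubtype_apply_of_mem w hi]
      simp only [hi, iff_false]
      intro h
      exact hw ⟨i, hi⟩ (Subtype.ext h)
  · intro w _ w' _ h
    exact Equiv.Perm.ofSubtype_injective h
  · intro w hw
    simp only [mem_filter, mem_univ, true_and] at hw
    have hfix : ∀ i, w i = i ↔ i ∈ F := by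
      intro i; rw [← hw]; simp
    have hm : ∀ i, i ∉ F ↔ w i ∉ F := by
      intro i
      rw [← hfix, ← hfix]
      simp
    refine ⟨w.subtypePerm (fun i => (hm i).symm), ?_, ?_⟩
    · simp only [mem_filter, mem_univ, true_and]
      rintro ⟨i, hi⟩ h
      exact hi ((hfix i).1 (by simpa using h))
    · apply Equiv.Perm.ofSubtype_subtypePerm
      intro i hi h
      exact hi ((hfix i).2 h)
  · intro w hw
    simp only [mem_filter, mem_univ, true_and] at hw
    have hF : univ.filter (fun i => Equiv.Perm.ofSubtype w i = i) = F := by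
      ext i
      simp only [mem_filter, mem_univ, true_and]
      by_cases hi : i ∈ F
      · simp [Equiv.Perm.ofSubtype_apply_of_not_mem w (a := i) (by simpa using hi), hi]
      · rw [Equiv.Perm.ofSubtype_apply_of_mem w hi]
        simp only [hi, iff_false]
        intro h
        exact hw ⟨i, hi⟩ (Subtype.ext h)
    rw [hF, mul_comm]
    congr 2
    refine card_bij (fun i _ => i.1) ?_ ?_ ?_
    · rintro ⟨i, hi⟩ h
      simpa [Equiv.Perm.ofSubtype_apply_of_mem w hi] using h
    · intro a _ b _ h
      exact Subtype.ext h
    · intro i h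
      simp only [mem_filter, mem_univ, true_and] at h
      by_cases hi : i ∈ F
      · rw [Equiv.Perm.ofSubtype_apply_of_not_mem w (a := i) (by simpa using hi)] at h
        exact absurd h (lt_irrefl _)
      · refine ⟨⟨i, hi⟩, ?_, rfl⟩
        simpa [Equiv.Perm.ofSubtype_apply_of_mem w hi] using h

lemma sum_powerset_card {n : ℕ} (g : ℕ → Polynomial ℝ) :
    ∑ F : Finset (Fin n), g F.card = ∑ j ∈ range (n + 1), (n.choose j : Polynomial ℝ) * g j := by
  have := Finset.sum_powerset_apply_card g (x := (univ : Finset (Fin n)))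
  simpa using this

lemma exc_fix (n : ℕ) : excPoly n = 
    ∑ j ∈ range (n + 1), (n.choose j : Polynomial ℝ) * dA (n - j) := by
  have := fix_sum (n := n) (fun i => (i : ℤ)) (fun a b h => by simpa [Fin.ext_iff] using h)
    (fun _ => 1)
  simp only [prod_const_one, mul_one, one_mul] at this
  rw [sum_powerset_card (fun j => dA (n - j))] at this
  rw [← this]
  refine sum_congr rfl fun w _ => ?_
  simp [excA]

lemma wexc_fix (n : ℕ) : ∑ w : Equiv.Perm (Fin n), (X : Polynomial ℝ) ^ wexcA w = 
    ∑ j ∈ range (n + 1), (n.choose j : Polynomial ℝ) * (X ^ j * dA (n - j)) := by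
  have := fix_sum (n := n) (fun i => (i : ℤ)) (fun a b h => by simpa [Fin.ext_iff] using h)
    (fun _ => X)
  simp only [prod_const] at this
  rw [sum_powerset_card (fun j => X ^ j * dA (n - j))] at this
  rw [← this]
  refine sum_congr rfl fun w _ => ?_
  rw [← pow_add, wexcA]
  congr 1
  rw [← card_union_of_disjoint]
  · congr 1
    ext i
    simp [Fin.ext_iff, le_iff_lt_or_eq, eq_comm]
  · rw [disjoint_filter]
    intro i _ h h'
    rw [h'] at h
    exact lt_irrefl _ h

/-- signed value -/
def sVal {n : ℕ} (s : Fin n → Bool) (k : Fin n) : ℤ :=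
  if s k then ((k : ℤ) + 1) else -((k : ℤ) + 1)

lemma sVal_inj {n : ℕ} (s : Fin n → Bool) : Function.Injective (sVal s) := by
  intro a b h
  unfold sVal at h
  ext
  split_ifs at h <;> omega

/-- word of a signed permutation -/
def mkW {n : ℕ} (q : (Fin n → Bool) × Equiv.Perm (Fin n)) (i : Fin n) : Fin n × Bool :=
  (q.2 i, q.1 (q.2 i))

lemma letterW_mkW {n : ℕ} (q : (Fin n → Bool) × Equiv.Perm (Fin n)) (i : Fin n) :
    letterW (mkW q) i = sVal q.1 (q.2 i) := rfl

lemma aVal_mkW {n : ℕ} (q : (Fin n → Bool) × Equiv.Perm (Fin n)) (i : Fin n) :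
    aVal (mkW q) i = sVal q.1 i := by
  unfold aVal sVal
  congr 1
  simp only [mkW, Prod.mk.injEq, eq_iff_iff]
  constructor
  · rintro ⟨j, h1, h2⟩
    rwa [h1] at h2
  · intro h
    exact ⟨q.2.symm i, by simp, by simpa using h⟩

lemma sum_mkW {n : ℕ} (g : (Fin n → Fin n × Bool) → Polynomial ℝ) :
    ∑ u ∈ univ.filter (fun u : Fin n → Fin n × Bool => IsSP u), g u =
    ∑ s : Fin n → Bool, ∑ w : Equiv.Perm (Fin n), g (mkW (s, w)) := by
  rw [← Fintype.sum_prod_type']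
  symm
  refine sum_bij (fun q _ => mkW q) ?_ ?_ ?_ ?_
  · intro q _
    simp only [mem_filter, mem_univ, true_and]
    exact q.2.bijective
  · rintro ⟨s, w⟩ _ ⟨s', w'⟩ _ h
    have h1 : w = w' := by
      ext i
      have := congrArg Prod.fst (congrFun h i)
      simp only [mkW] at this
      rw [this]
    subst h1
    congr 1
    ext i
    have := congrArg Prod.snd (congrFun h (w.symm i))
    simpa [mkW] using this
  · intro u hu
    simp only [mem_filter, mem_univ, true_and] at hu
    let w : Equiv.Perm (Fin n) := Equiv.ofBijective _ hu
    refine ⟨(fun k => (u (w.symm k)).2, w), mem_univ _, ?_⟩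
    funext i
    simp only [mkW, Equiv.symm_apply_apply]
    rfl
  · intros; rfl

lemma dB_term {n : ℕ} (s : Fin n → Bool) (w : Equiv.Perm (Fin n)) :
    (if IsDerB (mkW (s, w)) then (X : Polynomial ℝ) ^ excB (mkW (s, w)) else 0) =
    X ^ (univ.filter fun i => sVal s i < sVal s (w i)).card *
      ∏ i ∈ univ.filter (fun i => w i = i), (if s i then 0 else X) := by
  have hpos : ∀ i, 0 < sVal s i ↔ s i = true := by
    intro i; unfold sVal; split_ifs with h <;> simp [h] <;> omega
  have hneg : ∀ i, sVal s i < 0 ↔ s i = false := by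
    intro i; unfold sVal; split_ifs with h <;> simp [h] <;> omega
  have hd : IsDerB (mkW (s, w)) ↔ ∀ i, s i = true → w i ≠ i := by
    unfold IsDerB
    simp only [aVal_mkW, letterW_mkW, hpos, ne_eq, (sVal_inj s).eq_iff]
  split_ifs with h
  · rw [hd] at h
    have h3 : ∏ i ∈ univ.filter (fun i => w i = i), (if s i then (0 : Polynomial ℝ) else X) =
        X ^ (univ.filter (fun i => w i = i)).card := by
      rw [← prod_const]
      refine prod_congr rfl fun i hi => ?_
      simp only [mem_filter, mem_univ, true_and] at hi
      rw [if_neg]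
      intro hs
      exact h i hs hi
    rw [h3, ← pow_add]
    congr 1
    rw [← card_union_of_disjoint]
    · unfold excB
      congr 1
      ext i
      simp only [mem_filter, mem_univ, true_and, mem_union, aVal_mkW, letterW_mkW, hneg,
        (sVal_inj s).eq_iff]
      have := h i
      grind
    · rw [disjoint_filter]
      intro i _ h h'
      rw [h'] at h
      exact lt_irrefl _ h
  · rw [hd] at h
    push Not at h
    obtain ⟨i, hs, hw⟩ := h
    symm
    apply mul_eq_zero_of_right
    exact prod_eq_zero (i := i) (by simp [hw]) (by simp [hs])

lemma sum_signs {n : ℕ} (F : Finset (Fin n)) :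
    ∑ s : Fin n → Bool, ∏ i ∈ F, (if s i then (0 : Polynomial ℝ) else X) =
      X ^ F.card * 2 ^ (n - F.card) := by
  have h : ∀ s : Fin n → Bool, ∏ i ∈ F, (if s i then (0 : Polynomial ℝ) else X) =
      ∏ i, (if i ∈ F then (if s i then (0 : Polynomial ℝ) else X) else 1) := by
    intro s
    rw [prod_ite_mem]; simp
  simp_rw [h]
  rw [← Fintype.prod_sum (fun (i : Fin n) (b : Bool) => 
    if i ∈ F then (if b then (0 : Polynomial ℝ) else X) else 1)]
  have h2 : ∀ i : Fin n, ∑ b : Bool, (if i ∈ F then (if b then (0 : Polynomial ℝ) else X) else 1)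
      = if i ∈ F then X else 2 := by
    intro i
    split_ifs <;> simp
  simp_rw [h2]
  rw [prod_ite, prod_const, prod_const]
  congr 2
  · simp
  · rw [filter_not, filter_mem_eq_inter, univ_inter, card_univ_diff, Fintype.card_fin]

lemma dB_eq (n : ℕ) : dB n = 
    ∑ j ∈ range (n + 1), (n.choose j : Polynomial ℝ) * (X ^ j * (2 ^ (n - j) * dA (n - j))) := by
  unfold dB
  rw [← filter_filter, sum_filter, sum_mkW]
  simp_rw [dB_term, fix_sum _ (sVal_inj _)]
  rw [sum_comm]
  simp_rw [← sum_mul, sum_signs]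
  rw [← sum_powerset_card]
  simp_rw [mul_assoc]

/-- exponential generating function -/
noncomputable def egf (a : ℕ → Polynomial ℝ) : PowerSeries (Polynomial ℝ) :=
  PowerSeries.mk fun n => Polynomial.C ((n.factorial : ℝ)⁻¹) * a n

lemma coeff_egf (a : ℕ → Polynomial ℝ) (n : ℕ) :
    PowerSeries.coeff n (egf a) = Polynomial.C ((n.factorial : ℝ)⁻¹) * a n := by
  simp [egf]

lemma egf_mul (a b : ℕ → Polynomial ℝ) : egf a * egf b =
    egf (fun n => ∑ j ∈ range (n + 1), (n.choose j : Polynomial ℝ) * (a j * b (n - j))) := by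
  ext1 n
  rw [PowerSeries.coeff_mul, Finset.Nat.sum_antidiagonal_eq_sum_range_succ_mk, coeff_egf, mul_sum]
  refine sum_congr rfl fun j hj => ?_
  have hj' : j ≤ n := Nat.lt_succ_iff.1 (mem_range.1 hj)
  simp only [coeff_egf]
  have h : (C ((j.factorial : ℝ)⁻¹) * C (((n - j).factorial : ℝ)⁻¹) : Polynomial ℝ) =
      C ((n.factorial : ℝ)⁻¹) * (n.choose j : Polynomial ℝ) := by
    rw [← C_eq_natCast, ← C_mul, ← C_mul]
    congr 1
    have h1 := Nat.choose_mul_factorial_mul_factorial hj'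
    have h2 : (n.choose j : ℝ) * j.factorial * (n - j).factorial = n.factorial := by
      exact_mod_cast h1
    have := Nat.factorial_ne_zero j
    have := Nat.factorial_ne_zero (n - j)
    have := Nat.factorial_ne_zero n
    field_simp
    linarith
  calc _ = (C ((j.factorial : ℝ)⁻¹) * C (((n - j).factorial : ℝ)⁻¹)) * (a j * b (n - j)) := by ring
    _ = _ := by rw [h]; ring

lemma egf_congr {a b : ℕ → Polynomial ℝ} (h : ∀ n, a n = b n) : egf a = egf b := by
  rw [funext h]

lemma egf_one_add (a : ℕ → Polynomial ℝ) (b : ℕ → Polynomial ℝ) (c : Polynomial ℝ) (h0 : b 0 = 0)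
    (h1 : a 0 = 1)
    (h : ∀ n, a (n + 1) = c * b (n + 1)) : egf a = 1 + PowerSeries.C c * egf b := by
  ext1 n
  rw [map_add, PowerSeries.coeff_C_mul, coeff_egf, coeff_egf]
  rcases n with _ | n
  · simp [h0, h1]
  · rw [h, PowerSeries.coeff_one, if_neg (Nat.succ_ne_zero n)]
    ring

lemma egf_exp_sq (c : Polynomial ℝ) : 
    PowerSeries.rescale (2 : Polynomial ℝ) (egf (fun n => c ^ n)) = egf (fun n => c ^ n) ^ 2 := by
  rw [sq, egf_mul]
  ext1 n
  rw [PowerSeries.coeff_rescale, coeff_egf, coeff_egf]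
  have : ∑ j ∈ range (n + 1), (n.choose j : Polynomial ℝ) * (c ^ j * c ^ (n - j)) =
      (2 * c) ^ n := by
    rw [two_mul, add_pow]
    exact sum_congr rfl fun j _ => by ring
  rw [this]
  ring

lemma excPoly_zero : excPoly 0 = 1 := by simp [excPoly, excA]

lemma Apoly_succ (n : ℕ) : Apoly (n + 1) = excPoly (n + 1) := by
  rw [← desPoly_eq_excPoly]; simp [Apoly, desPoly]

lemma rel1 : egf (fun n => 1 ^ n) * egf dA = 1 + egf Apoly := by
  rw [egf_mul]
  have := egf_one_add excPoly Apoly 1 (by simp [Apoly]) excPoly_zero 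
    (fun n => by rw [Apoly_succ, one_mul])
  rw [map_one, one_mul] at this
  rw [← this]
  refine egf_congr fun n => ?_
  rw [exc_fix]
  exact sum_congr rfl fun j _ => by simp

lemma rel2 : egf (fun n => X ^ n) * egf dA = 1 + PowerSeries.C X * egf Apoly := by
  rw [egf_mul, ← egf_one_add (fun n => ∑ w : Equiv.Perm (Fin n), (X : Polynomial ℝ) ^ wexcA w)
    Apoly X (by simp [Apoly]) (by simp [wexcA]) (fun n => by rw [Apoly_succ, wexc_sum])]
  refine egf_congr fun n => ?_
  rw [wexc_fix]

lemma rel3 : egf dB = egf (fun n => X ^ n) * PowerSeries.rescale (2 : Polynomial ℝ) (egf dA) := by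
  have : PowerSeries.rescale (2 : Polynomial ℝ) (egf dA) = egf (fun n => 2 ^ n * dA n) := by
    ext1 n
    rw [PowerSeries.coeff_rescale, coeff_egf, coeff_egf]
    ring
  rw [this, egf_mul]
  exact egf_congr fun n => dB_eq n

lemma main_rel : egf dB * (1 - PowerSeries.C X * egf Apoly ^ 2) = 
    egf dA * (1 + PowerSeries.C X * egf Apoly) := by
  have h1 := rel1
  have h2 := rel2
  rw [rel3]
  set u := egf (fun n => 1 ^ n) with hu
  set v := egf (fun n => X ^ n) with hv
  set D := egf dA
  set A := egf Apoly
  set x : PowerSeries (Polynomial ℝ) := PowerSeries.C X with hx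
  have h4 : (v - x * u) * D = 1 - x := by linear_combination h2 - x * h1
  have h5 := congrArg (PowerSeries.rescale (2 : Polynomial ℝ)) h4
  have hx2 : PowerSeries.rescale (2 : Polynomial ℝ) x = x := by
    rw [hx]; ext1 n
    rw [PowerSeries.coeff_rescale, PowerSeries.coeff_C]
    split_ifs with h <;> simp [h]
  simp only [map_mul, map_sub, map_one, hx2, hu, hv, egf_exp_sq] at h5
  rw [← hu, ← hv] at h5
  set D2 := PowerSeries.rescale (2 : Polynomial ℝ) D
  have hne : (1 - x : PowerSeries (Polynomial ℝ)) ≠ 0 := by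
    intro h
    have := congrArg (PowerSeries.coeff 0) h
    rw [hx, map_sub, PowerSeries.coeff_zero_C] at this
    simp only [PowerSeries.coeff_zero_one, map_zero] at this
    have := congrArg (Polynomial.coeff · 0) this
    simp at this
  have hne2 : v ^ 2 - x * u ^ 2 ≠ 0 := by
    intro h
    rw [h, zero_mul] at h5
    exact hne h5.symm
  have h6 : D2 * (1 - x * A ^ 2) = D ^ 2 := by
    apply mul_left_cancel₀ hne2
    have e1 : (v ^ 2 - x * u ^ 2) * (D2 * (1 - x * A ^ 2)) = (1 - x) * (1 - x * A ^ 2) := by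
      rw [← mul_assoc, h5]
    have e2 : (v ^ 2 - x * u ^ 2) * D ^ 2 = (v * D) ^ 2 - x * (u * D) ^ 2 := by ring
    rw [e1, e2, h1, h2]
    ring
  calc v * D2 * (1 - x * A ^ 2) = v * (D2 * (1 - x * A ^ 2)) := by ring
    _ = D * (v * D) := by rw [h6]; ring
    _ = _ := by rw [h2]

lemma geom_half {R : Type*} [CommRing R] (x A : R) (N : ℕ) :
    (∑ k ∈ range (2 * N), x ^ ((k + 1) / 2) * A ^ k) * (1 - x * A ^ 2) =
      (1 + x * A) * (1 - x ^ N * A ^ (2 * N)) := by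
  induction N with
  | zero => simp
  | succ N ih =>
    rw [show 2 * (N + 1) = 2 * N + 1 + 1 by ring, sum_range_succ, sum_range_succ, add_mul, add_mul,
      ih, show (2 * N + 1) / 2 = N by omega, show (2 * N + 1 + 1) / 2 = N + 1 by omega]
    ring

lemma coeff_pow_lt (F : PowerSeries (Polynomial ℝ)) (k n : ℕ) (h : n < k) :
    PowerSeries.coeff n (F * egf Apoly ^ k) = 0 := by
  have h1 : (PowerSeries.X : PowerSeries (Polynomial ℝ)) ∣ egf Apoly := by
    rw [PowerSeries.X_dvd_iff, ← PowerSeries.coeff_zero_eq_constantCoeff_apply, coeff_egf]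
    simp [Apoly]
  have h2 : (PowerSeries.X : PowerSeries (Polynomial ℝ)) ^ k ∣ F * egf Apoly ^ k :=
    Dvd.dvd.mul_left (pow_dvd_pow_of_dvd h1 k) F
  exact PowerSeries.X_pow_dvd_iff.1 h2 n h

lemma coeff_dB (n : ℕ) : PowerSeries.coeff n (egf dB) =
    ∑ k ∈ range (n + 1), X ^ ((k + 1) / 2) * PowerSeries.coeff n (egf dA * egf Apoly ^ k) := by
  have hm := main_rel
  have hg := geom_half (PowerSeries.C (X : Polynomial ℝ)) (egf Apoly) (n + 1)
  set A := egf Apoly with hA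
  set x : PowerSeries (Polynomial ℝ) := PowerSeries.C X with hx
  have hne : 1 - x * A ^ 2 ≠ 0 := by
    intro h
    have := congrArg (PowerSeries.coeff 0) h
    rw [map_sub, hA, coeff_pow_lt _ 2 0 (by norm_num)] at this
    simp at this
  have h1 : egf dA * (∑ k ∈ range (2 * (n + 1)), x ^ ((k + 1) / 2) * A ^ k) = 
      egf dB - (egf dB * x ^ (n + 1)) * A ^ (2 * (n + 1)) := by
    apply mul_right_cancel₀ hne
    rw [mul_assoc, hg, ← mul_assoc, ← hm]
    ring
  have h2 := congrArg (PowerSeries.coeff n) h1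
  rw [map_sub, hA, coeff_pow_lt _ _ n (by omega), sub_zero] at h2
  rw [← h2, mul_sum, map_sum, ← sum_subset (range_mono (show n + 1 ≤ 2 * (n + 1) by omega))]
  · refine sum_congr rfl fun k _ => ?_
    rw [mul_left_comm, hx, ← map_pow, PowerSeries.coeff_C_mul]
  · intro k _ hk
    rw [← mul_assoc]
    apply coeff_pow_lt
    simp at hk
    omega

lemma coeff_prod_tuple (k n : ℕ) (F : Fin k → PowerSeries (Polynomial ℝ)) :
    PowerSeries.coeff n (∏ i, F i) =
      ∑ r ∈ Finset.Nat.antidiagonalTuple k n, ∏ i, PowerSeries.coeff (r i) (F i) := by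
  rw [PowerSeries.coeff_prod]
  refine sum_bij (fun l _ => (l : Fin k → ℕ)) ?_ ?_ ?_ ?_
  · intro l hl
    rw [mem_finsuppAntidiag] at hl
    rw [Finset.Nat.mem_antidiagonalTuple]
    exact hl.1
  · intro a _ b _ h
    exact DFunLike.coe_injective h
  · intro r hr
    rw [Finset.Nat.mem_antidiagonalTuple] at hr
    refine ⟨Finsupp.equivFunOnFinite.symm r, ?_, ?_⟩
    · rw [mem_finsuppAntidiag]
      exact ⟨by simpa using hr, subset_univ _⟩
    · simp
  · intros; rfl

lemma coeff_term (k n : ℕ) : (n.factorial : Polynomial ℝ) * 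
    PowerSeries.coeff n (egf dA * egf Apoly ^ k) =
    ∑ r ∈ Finset.Nat.antidiagonalTuple (k + 1) n,
        (Nat.multinomial Finset.univ r : Polynomial ℝ) *
          (dA (r 0) * ∏ i : Fin k, Apoly (r i.succ)) := by
  have h : egf dA * egf Apoly ^ k =
      ∏ i : Fin (k + 1), egf ((Fin.cons dA (fun _ => Apoly) : Fin (k + 1) → ℕ → Polynomial ℝ) i) := by
    rw [Fin.prod_univ_succ]; simp
  rw [h, coeff_prod_tuple, mul_sum]
  refine sum_congr rfl fun r hr => ?_
  rw [Finset.Nat.mem_antidiagonalTuple] at hr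
  simp only [coeff_egf]
  rw [prod_mul_distrib, Fin.prod_univ_succ (fun i => 
    (Fin.cons dA (fun _ => Apoly) : Fin (k + 1) → ℕ → Polynomial ℝ) i (r i))]
  simp only [Fin.cons_zero, Fin.cons_succ]
  rw [← mul_assoc]
  congr 1
  have hs := Nat.multinomial_spec univ r
  rw [hr] at hs
  rw [← hs, ← map_prod, ← C_eq_natCast, ← C_eq_natCast, ← C_mul]
  congr 1
  push_cast
  rw [mul_right_comm, ← prod_mul_distrib, prod_eq_one, one_mul]
  intro i _
  exact mul_inv_cancel₀ (by exact_mod_cast Nat.factorial_ne_zero _)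

/-- **Theorem (main formula).** For every `n`,
`d_n^B(x) = Σ (n choose r_0,…,r_k) x^⌊(k+1)/2⌋ d_{r_0}(x) A_{r_1}(x) ⋯ A_{r_k}(x)`,
summed over all `k ∈ ℕ` and sequences of nonnegative integers summing to `n`
(with the convention `A_0 = 0`; all terms with `k > n` vanish). -/
theorem dB_eq_multinomial_sum (n : ℕ) :
    dB n = ∑ k ∈ Finset.range (n + 1),
      ∑ r ∈ Finset.Nat.antidiagonalTuple (k + 1) n,
        (Nat.multinomial Finset.univ r : Polynomial ℝ) * X ^ ((k + 1) / 2) *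
          dA (r 0) * ∏ i : Fin k, Apoly (r i.succ) := by
  have h1 : (n.factorial : Polynomial ℝ) * PowerSeries.coeff n (egf dB) = dB n := by
    rw [coeff_egf, ← mul_assoc, ← C_eq_natCast, ← C_mul, mul_inv_cancel₀, C_1, one_mul]
    exact_mod_cast Nat.factorial_ne_zero _
  rw [← h1, coeff_dB, mul_sum]
  refine sum_congr rfl fun k _ => ?_
  rw [mul_left_comm, coeff_term, mul_sum]
  refine sum_congr rfl fun r _ => ?_
  ring
end

section
/- For every natural number n, f_n^+(x) = Σ (n choose r_0, r_1, …, r_{2k}) · x^k · d_{r_0}(x) · A_{r_1}(x) ⋯ A_{r_{2k}}(x), where the sum ranges over all k ∈ ℕ and all sequences (r_0, r_1, …, r_{2k}) of nonnegative integers with r_0 + ⋯ + r_{2k} = n and r_i ≥ 1 for 1 ≤ i ≤ 2k (equivalently, over all such sequences of nonnegative integers with the convention A_0(x) = 0). -/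
open Polynomial Finset

/-! ### Descents -/

namespace FP

theorem desA_succ {n : ℕ} (w : Equiv.Perm (Fin (n+1))) :
    desA w = ∑ i : Fin n, if w i.succ < w i.castSucc then 1 else 0 := by
  unfold desA
  rw [card_filter, Fin.sum_univ_castSucc]
  simp only [Fin.val_last, lt_irrefl, false_and, if_false, add_zero]
  refine sum_congr rfl fun i _ => ?_
  have h1 : (i.castSucc : ℕ) + 1 < n + 1 := by simp
  have h2 : (⟨((i.castSucc : ℕ) + 1) % (n+1), Nat.mod_lt _ (Nat.succ_pos _)⟩ : Fin (n+1)) = i.succ := by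
    ext; simp [Nat.mod_eq_of_lt]
  simp only [h1, true_and]
  rw [h2]

/-- Eulerian polynomials with `A_0 = 1`. -/
noncomputable def As (n : ℕ) : ℝ[X] := ∑ w : Equiv.Perm (Fin n), X ^ desA w

/-- refinement by first value -/
noncomputable def aa (n : ℕ) (p : Fin (n+1)) : ℝ[X] :=
  ∑ w : Equiv.Perm (Fin (n+1)), if w 0 = p then X ^ desA w else 0

theorem desA_ins {n : ℕ} (p : Fin (n+2)) (e : Equiv.Perm (Fin (n+1))) :
    desA (p.cycleRange.symm * Equiv.Perm.decomposeFin.symm (0, e)) =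
      desA e + if (e 0).castSucc < p then 1 else 0 := by
  rw [desA_succ, desA_succ, Fin.sum_univ_succ, add_comm]
  congr 1
  · refine sum_congr rfl fun i _ => ?_
    simp only [Equiv.Perm.mul_apply, Fin.castSucc_succ, Equiv.Perm.decomposeFin_symm_apply_succ,
      Equiv.swap_self, Equiv.refl_apply, Fin.cycleRange_symm_succ, Fin.succAbove_lt_succAbove_iff]
  · simp only [Equiv.Perm.mul_apply, Fin.castSucc_zero, Equiv.Perm.decomposeFin_symm_apply_succ,
      Equiv.swap_self, Equiv.refl_apply, Fin.cycleRange_symm_succ,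
      Equiv.Perm.decomposeFin_symm_apply_zero, Fin.cycleRange_symm_zero, Fin.succAbove_lt_iff_castSucc_lt]

theorem aa_succ (n : ℕ) (p : Fin (n+2)) :
    aa (n+1) p = ∑ e : Equiv.Perm (Fin (n+1)), X ^ desA e * if (e 0).castSucc < p then X else 1 := by
  unfold aa
  rw [← Equiv.sum_comp (Equiv.mulLeft p.cycleRange.symm),
    ← Equiv.sum_comp (Equiv.Perm.decomposeFin.symm), Fintype.sum_prod_type]
  rw [Finset.sum_eq_single 0]
  · refine sum_congr rfl fun e _ => ?_
    have h0 : (Equiv.mulLeft p.cycleRange.symm (Equiv.Perm.decomposeFin.symm (0, e))) 0 = p := by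
      rw [Equiv.coe_mulLeft, Equiv.Perm.mul_apply, Equiv.Perm.decomposeFin_symm_apply_zero, Fin.cycleRange_symm_zero]
    rw [if_pos h0, Equiv.coe_mulLeft, desA_ins, pow_add]
    congr 1
    by_cases h : (e 0).castSucc < p <;> simp [h]
  · intro q _ hq
    refine sum_eq_zero fun e _ => ?_
    rw [if_neg]
    simp only [Equiv.coe_mulLeft, Equiv.Perm.mul_apply, Equiv.Perm.decomposeFin_symm_apply_zero]
    intro h
    apply hq
    rw [Equiv.symm_apply_eq] at h
    simpa using h
  · simp

theorem aa_zero (n : ℕ) : aa n 0 = As n := by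
  cases n with
  | zero =>
    unfold aa As
    have : ∀ w : Equiv.Perm (Fin 1), desA w = 0 := fun w => by simp [desA_succ]
    have h2 : ∀ w : Equiv.Perm (Fin 0), desA w = 0 := fun w => by simp [desA]
    have h3 : ∀ w : Equiv.Perm (Fin 1), w 0 = 0 := fun w => Subsingleton.elim _ _
    simp [this, h2, h3]
  | succ n => rw [aa_succ]; simp [As]

theorem aa_last (n : ℕ) : aa (n+1) (Fin.last _) = X * As (n+1) := by
  rw [aa_succ, As, mul_sum]
  refine sum_congr rfl fun e _ => ?_
  rw [if_pos (Fin.castSucc_lt_last _), mul_comm]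

theorem aa_diff (n : ℕ) (p : Fin (n+1)) :
    aa (n+1) p.succ = aa (n+1) p.castSucc + (X - 1) * aa n p := by
  rw [aa_succ, aa_succ]
  unfold aa
  rw [mul_sum, ← sum_add_distrib]
  refine sum_congr rfl fun e _ => ?_
  simp only [Fin.castSucc_lt_succ_iff, Fin.castSucc_lt_castSucc_iff]
  rcases lt_trichotomy (e 0) p with h | h | h
  · simp [h, h.le, h.ne]
  · simp [h]; ring
  · simp [h.not_ge, h.not_gt, h.ne']

theorem aa_newton (p : ℕ) : ∀ (n : ℕ) (h : p < n + 1), aa n ⟨p, h⟩ =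
    ∑ ij ∈ antidiagonal p, (p.choose ij.1 : ℝ[X]) * ((X - 1) ^ ij.1 * As (n - ij.1)) := by
  induction p with
  | zero => intro n h; simpa using aa_zero n
  | succ p ih =>
    intro n h
    obtain ⟨n, rfl⟩ : ∃ m, n = m + 1 := ⟨n - 1, by omega⟩
    have h' : p < n + 1 := by omega
    have := aa_diff n ⟨p, h'⟩
    simp only [Fin.succ_mk, Fin.castSucc_mk] at this
    rw [this, ih, ih]
    rw [Finset.sum_antidiagonal_choose_succ_mul (fun i _ => (X - 1) ^ i * As (n + 1 - i))]
    rw [mul_sum]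
    refine congrArg₂ (· + ·) rfl ?_
    refine sum_congr rfl fun ij hij => ?_
    have : ij.1 + ij.2 = p := by simpa using hij
    rw [Nat.choose_symm_of_eq_add (show p = ij.1 + ij.2 by omega)]
    rw [show n + 1 - (ij.1 + 1) = n - ij.1 by omega]
    ring

theorem As_rec (n : ℕ) :
    ∑ ij ∈ antidiagonal n, (n.choose ij.1 : ℝ[X]) * ((X - 1) ^ ij.1 * As ij.2) =
      X * As n + if n = 0 then 1 - X else 0 := by
  cases n with
  | zero => 
    have h2 : ∀ w : Equiv.Perm (Fin 0), desA w = 0 := fun w => by simp [desA]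
    simp [As, h2]
  | succ n =>
    rw [← aa_last]
    have := aa_newton (n+1) (n+1) (by omega)
    rw [show Fin.last (n+1) = ⟨n+1, by omega⟩ from rfl, this, if_neg (Nat.succ_ne_zero n), add_zero]
    refine sum_congr rfl fun ij hij => ?_
    have : ij.1 + ij.2 = n + 1 := by simpa using hij
    rw [show n + 1 - ij.1 = ij.2 by omega]

/-! ### Excedances -/

/-- excedance polynomials -/
noncomputable def Pe (n : ℕ) : ℝ[X] := ∑ w : Equiv.Perm (Fin n), X ^ excA w

theorem exc_ins_zero {n : ℕ} (e : Equiv.Perm (Fin n)) :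
    excA (Equiv.Perm.decomposeFin.symm (0, e)) = excA e := by
  unfold excA
  rw [card_filter, card_filter, Fin.sum_univ_succ]
  simp

theorem exc_ins_succ {n : ℕ} (i : Fin n) (e : Equiv.Perm (Fin n)) :
    excA (Equiv.Perm.decomposeFin.symm ((e i).succ, e)) + (if i < e i then 1 else 0) = excA e + 1 := by
  unfold excA
  rw [card_filter, card_filter, Fin.sum_univ_succ]
  simp only [Equiv.Perm.decomposeFin_symm_apply_zero, Equiv.Perm.decomposeFin_symm_apply_succ,
    Fin.succ_pos, if_true]
  rw [← Finset.add_sum_erase _ _ (mem_univ i), ← Finset.add_sum_erase univ (fun j => if j < e j then 1 else 0) (mem_univ i)]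
  have : ∑ j ∈ univ.erase i, (if j.succ < (Equiv.swap 0 (e i).succ) (e j).succ then 1 else 0) =
      ∑ j ∈ univ.erase i, (if j < e j then 1 else 0) := by
    refine sum_congr rfl fun j hj => ?_
    have hj : j ≠ i := by simpa using hj
    rw [Equiv.swap_apply_of_ne_of_ne (Fin.succ_ne_zero _)]
    · simp
    · simpa using hj
  rw [this]
  simp
  omega

theorem sum_exc_ins {n : ℕ} (e : Equiv.Perm (Fin n)) :
    ∑ j : Fin n, (X : ℝ[X]) ^ excA (Equiv.Perm.decomposeFin.symm (j.succ, e)) =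
      (n : ℝ[X]) * X * X ^ excA e + X * (1 - X) * derivative (X ^ excA e) := by
  rw [← Equiv.sum_comp e]
  have key : ∀ i, (X : ℝ[X]) ^ excA (Equiv.Perm.decomposeFin.symm ((e i).succ, e)) =
      X * X ^ excA e + (if i < e i then 1 else 0) * (X ^ excA e * (1 - X)) := by
    intro i
    have := exc_ins_succ i e
    split_ifs at this ⊢
    · rw [show excA (Equiv.Perm.decomposeFin.symm ((e i).succ, e)) = excA e by omega]; ring
    · rw [show excA (Equiv.Perm.decomposeFin.symm ((e i).succ, e)) = excA e + 1 by omega]; ring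
  simp only [key, sum_add_distrib, ← sum_mul]
  have : ∑ i, (if i < e i then (1 : ℝ[X]) else 0) = (excA e : ℝ[X]) := by
    unfold excA; simp
  rw [this]
  have h3 : (X : ℝ[X]) * derivative (X ^ excA e : ℝ[X]) = (excA e : ℝ[X]) * X ^ excA e := by
    rcases Nat.eq_zero_or_pos (excA e) with h | h
    · simp [h]
    · obtain ⟨m, hm⟩ := Nat.exists_eq_succ_of_ne_zero h.ne'
      rw [hm]; simp; ring
  simp only [sum_const, card_univ, Fintype.card_fin, nsmul_eq_mul]
  linear_combination -(1 - X) * h3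

theorem Pe_succ (n : ℕ) :
    Pe (n+1) = (1 + (n : ℝ[X]) * X) * Pe n + X * (1 - X) * derivative (Pe n) := by
  have h0 : Pe (n+1) = ∑ e : Equiv.Perm (Fin n),
      ∑ p : Fin (n+1), (X : ℝ[X]) ^ excA (Equiv.Perm.decomposeFin.symm (p, e)) := by
    unfold Pe
    rw [← Equiv.sum_comp (Equiv.Perm.decomposeFin.symm), Fintype.sum_prod_type, sum_comm]
  rw [h0]
  unfold Pe
  rw [derivative_sum, mul_sum, mul_sum, ← sum_add_distrib]
  refine sum_congr rfl fun e _ => ?_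
  rw [Fin.sum_univ_succ, exc_ins_zero, sum_exc_ins]
  ring

/-- auxiliary -/
noncomputable def cc (n : ℕ) : ℝ[X] :=
  ∑ ij ∈ antidiagonal n, (n.choose ij.1 : ℝ[X]) * ((X - 1) ^ ij.1 * Pe ij.2) - X * Pe n

theorem cc_succ (n : ℕ) :
    cc (n+1) = ((n : ℝ[X]) + 1) * X * cc n + X * (1 - X) * derivative (cc n) := by
  unfold cc
  rw [Finset.sum_antidiagonal_choose_succ_mul (fun i j => (X - 1) ^ i * Pe j)]
  have h2 : ∑ ij ∈ antidiagonal n, (n.choose ij.2 : ℝ[X]) * ((X - 1) ^ (ij.1 + 1) * Pe ij.2)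
    = ∑ ij ∈ antidiagonal n, (n.choose ij.1 : ℝ[X]) * ((X - 1) ^ (ij.1 + 1) * Pe ij.2) := by
    refine sum_congr rfl fun ij hij => ?_
    have : ij.1 + ij.2 = n := by simpa using hij
    rw [Nat.choose_symm_of_eq_add (show n = ij.1 + ij.2 by omega)]
  rw [h2, ← sum_add_distrib]
  have h3 : ∀ ij ∈ antidiagonal n,
      (n.choose ij.1 : ℝ[X]) * ((X - 1) ^ ij.1 * Pe (ij.2 + 1)) +
      (n.choose ij.1 : ℝ[X]) * ((X - 1) ^ (ij.1 + 1) * Pe ij.2) =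
      ((n : ℝ[X]) + 1) * X * ((n.choose ij.1 : ℝ[X]) * ((X - 1) ^ ij.1 * Pe ij.2)) +
        X * (1 - X) * derivative ((n.choose ij.1 : ℝ[X]) * ((X - 1) ^ ij.1 * Pe ij.2)) := by
    intro ij hij
    have hn : (n : ℝ[X]) = ij.1 + ij.2 := by
      have : ij.1 + ij.2 = n := by simpa using hij
      rw [← this]; push_cast; ring
    have hd : (X - 1) * derivative ((X - 1 : ℝ[X]) ^ ij.1) = (ij.1 : ℝ[X]) * (X - 1) ^ ij.1 := by
      rcases ij.1 with _ | m
      · simp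
      · rw [derivative_pow]; simp; ring
    rw [Pe_succ, derivative_mul, derivative_mul, derivative_natCast, hn]
    linear_combination (n.choose ij.1 : ℝ[X]) * X * Pe ij.2 * hd
  rw [sum_congr rfl h3, sum_add_distrib, ← mul_sum, ← mul_sum, ← derivative_sum, Pe_succ,
    derivative_sub, derivative_mul, derivative_X]
  ring

theorem cc_zero : cc 0 = 1 - X := by
  have h2 : ∀ w : Equiv.Perm (Fin 0), excA w = 0 := fun w => by simp [excA]
  simp [cc, Pe, h2]

theorem cc_eq (n : ℕ) : cc (n + 1) = 0 := by
  induction n with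
  | zero => rw [cc_succ, cc_zero]; simp
  | succ n ih => rw [cc_succ, ih]; simp

theorem Pe_rec (n : ℕ) :
    ∑ ij ∈ antidiagonal n, (n.choose ij.1 : ℝ[X]) * ((X - 1) ^ ij.1 * Pe ij.2) =
      X * Pe n + if n = 0 then 1 - X else 0 := by
  cases n with
  | zero => have := cc_zero; unfold cc at this; simp only [if_true]; linear_combination this
  | succ n => have := cc_eq n; unfold cc at this; simp; linear_combination this

/-! ### Removing fixed points -/

theorem exists_equiv {α : Type} [Fintype α] (f : α → ℤ) (hf : Function.Injective f) :
    ∃ e : α ≃ Fin (Fintype.card α), ∀ i j, e i < e j ↔ f i < f j := by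
  let _ : LinearOrder α := LinearOrder.lift' f hf
  refine ⟨(Fintype.orderIsoFinOfCardEq α rfl).symm.toEquiv, fun i j => ?_⟩
  exact (Fintype.orderIsoFinOfCardEq α rfl).symm.lt_iff_lt

theorem der_sum {α : Type} [Fintype α] [DecidableEq α] (f : α → ℤ) (hf : Function.Injective f) :
    ∑ σ ∈ univ.filter (fun σ : Equiv.Perm α => ∀ i, σ i ≠ i),
      (X : ℝ[X]) ^ (univ.filter fun i => f i < f (σ i)).card = dA (Fintype.card α) := by
  obtain ⟨e, he⟩ := exists_equiv f hf
  unfold dA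
  refine Finset.sum_equiv e.permCongr ?_ ?_
  · intro σ
    simp only [mem_filter, mem_univ, true_and]
    refine e.forall_congr fun i => ?_
    simp [Equiv.permCongr_apply]
  · intro σ _
    congr 1
    unfold excA
    refine Finset.card_equiv e fun i => ?_
    rw [mem_filter, mem_filter]
    simp [Equiv.permCongr_apply, he]

theorem fiber_sum {α : Type} [Fintype α] [DecidableEq α] (f : α → ℤ) (hf : Function.Injective f)
    (F : Finset α) :
    ∑ σ ∈ univ.filter (fun σ : Equiv.Perm α => (univ.filter fun i => σ i = i) = F),
      (X : ℝ[X]) ^ (univ.filter fun i => f i < f (σ i)).card = dA (Fintype.card α - F.card) := by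
  have hc : Fintype.card {a // a ∉ F} = Fintype.card α - F.card := by
    rw [Fintype.card_subtype_compl (fun a => a ∈ F)]; simp
  rw [← hc, ← der_sum (fun a : {a // a ∉ F} => f a) (hf.comp Subtype.val_injective)]
  symm
  refine Finset.sum_bij (fun τ _ => Equiv.Perm.ofSubtype τ) ?_ ?_ ?_ ?_
  · intro τ hτ
    simp only [mem_filter, mem_univ, true_and] at hτ ⊢
    ext i
    simp only [mem_filter, mem_univ, true_and]
    by_cases hi : i ∈ F
    · simp [hi, Equiv.Perm.ofSubtype_apply_of_not_mem τ (show ¬ (i ∉ F) by simpa using hi)]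
    · simp only [hi, iff_false]
      rw [Equiv.Perm.ofSubtype_apply_of_mem τ hi]
      intro h
      exact hτ ⟨i, hi⟩ (Subtype.ext h)
  · intro τ _ τ' _ h
    exact Equiv.Perm.ofSubtype_injective h
  · intro σ hσ
    simp only [mem_filter, mem_univ, true_and] at hσ
    have hmem : ∀ i, i ∈ F ↔ σ i = i := fun i => by rw [← hσ]; simp
    have hs : ∀ i, σ i ∉ F ↔ i ∉ F := fun i => by
      rw [hmem, hmem]; simp
    refine ⟨σ.subtypePerm hs, ?_, ?_⟩
    · simp only [mem_filter, mem_univ, true_and]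
      rintro ⟨i, hi⟩ h
      have h := congrArg Subtype.val h
      simp only [Equiv.Perm.subtypePerm_apply] at h
      exact hi ((hmem i).2 h)
    · refine Equiv.Perm.ofSubtype_subtypePerm hs fun i hi => ?_
      intro h; exact hi ((hmem i).1 h)
  · intro τ _
    congr 1
    rw [← Finset.card_map (Function.Embedding.subtype _)]
    congr 1
    ext i
    simp only [mem_map, mem_filter, mem_univ, true_and, Function.Embedding.subtype_apply]
    constructor
    · rintro ⟨j, hj, rfl⟩
      rw [Equiv.Perm.ofSubtype_apply_of_mem τ j.2]
      exact hj
    · intro h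
      by_cases hi : i ∈ F
      · rw [Equiv.Perm.ofSubtype_apply_of_not_mem τ (show ¬ (i ∉ F) by simpa using hi)] at h
        exact absurd h (lt_irrefl _)
      · rw [Equiv.Perm.ofSubtype_apply_of_mem τ hi] at h
        exact ⟨⟨i, hi⟩, h, rfl⟩

theorem removal {α : Type} [Fintype α] [DecidableEq α] (f : α → ℤ) (hf : Function.Injective f)
    (y : α → ℝ[X]) :
    ∑ σ : Equiv.Perm α, (X : ℝ[X]) ^ (univ.filter fun i => f i < f (σ i)).card *
        ∏ i ∈ univ.filter (fun i => σ i = i), y i =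
      ∑ F : Finset α, (∏ i ∈ F, y i) * dA (Fintype.card α - F.card) := by
  rw [← Finset.sum_fiberwise univ (fun σ : Equiv.Perm α => univ.filter fun i => σ i = i)]
  refine sum_congr rfl fun F _ => ?_
  rw [← fiber_sum f hf F, mul_sum]
  refine sum_congr rfl fun σ hσ => ?_
  have : (univ.filter fun i => σ i = i) = F := by simpa using hσ
  rw [this, mul_comm]

theorem sum_finset_card (n : ℕ) (g : ℕ → ℝ[X]) :
    ∑ F : Finset (Fin n), g F.card = ∑ ij ∈ antidiagonal n, (n.choose ij.1 : ℝ[X]) * g ij.1 := by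
  have := Finset.sum_powerset_apply_card g (x := (univ : Finset (Fin n)))
  rw [Finset.powerset_univ] at this
  rw [this, Finset.Nat.sum_antidiagonal_eq_sum_range_succ_mk]
  simp

theorem Pe_eq (n : ℕ) :
    Pe n = ∑ ij ∈ antidiagonal n, (n.choose ij.1 : ℝ[X]) * dA ij.2 := by
  have h := removal (fun i : Fin n => ((i : ℕ) : ℤ)) (fun i j h => by simpa [Fin.ext_iff] using h) (fun _ => 1)
  simp only [prod_const_one, mul_one, one_mul, Fintype.card_fin] at h
  rw [sum_finset_card n (fun k => dA (n - k))] at h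
  unfold Pe excA
  simp only [Nat.cast_lt, Fin.val_fin_lt] at h
  rw [h]
  refine sum_congr rfl fun ij hij => ?_
  have : ij.1 + ij.2 = n := by simpa using hij
  rw [show n - ij.1 = ij.2 by omega]

/-! ### Type B -/

/-- signed value -/
def sv {n : ℕ} (ε : Fin n → Bool) (k : Fin n) : ℤ :=
  if ε k then ((k : ℤ) + 1) else -((k : ℤ) + 1)

theorem sv_inj {n : ℕ} (ε : Fin n → Bool) : Function.Injective (sv ε) := by
  intro i j h
  unfold sv at h
  ext
  split_ifs at h <;> omega

/-- the word of a signed permutation -/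
def wd {n : ℕ} (σ : Equiv.Perm (Fin n)) (ε : Fin n → Bool) (i : Fin n) : Fin n × Bool :=
  (σ i, ε (σ i))

theorem aVal_wd {n : ℕ} (σ : Equiv.Perm (Fin n)) (ε : Fin n → Bool) (k : Fin n) :
    aVal (wd σ ε) k = sv ε k := by
  unfold aVal sv wd
  have : (∃ j, (σ j, ε (σ j)) = (k, true)) ↔ ε k = true := by
    constructor
    · rintro ⟨j, hj⟩
      simp only [Prod.mk.injEq] at hj
      rw [← hj.1]; exact hj.2
    · intro h
      exact ⟨σ.symm k, by simp [h]⟩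
  simp only [this]

theorem letterW_wd {n : ℕ} (σ : Equiv.Perm (Fin n)) (ε : Fin n → Bool) (k : Fin n) :
    letterW (wd σ ε) k = sv ε (σ k) := rfl

theorem sv_neg {n : ℕ} (ε : Fin n → Bool) (k : Fin n) : sv ε k < 0 ↔ ε k = false := by
  unfold sv
  split_ifs with h
  · simp [h]; try omega
  · simp [h]; try omega

theorem sv_pos {n : ℕ} (ε : Fin n → Bool) (k : Fin n) : 0 < sv ε k ↔ ε k = true := by
  unfold sv
  split_ifs with h
  · simp [h]; try omega
  · simp [h]; try omega

theorem weight_wd {n : ℕ} (σ : Equiv.Perm (Fin n)) (ε : Fin n → Bool) :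
    (if IsDerB (wd σ ε) then (X : ℝ[X]) ^ excB (wd σ ε) else 0) =
      X ^ (univ.filter fun i => sv ε i < sv ε (σ i)).card *
        ∏ i ∈ univ.filter (fun i => σ i = i), (if ε i then 0 else X) := by
  have hd : IsDerB (wd σ ε) ↔ ∀ k, σ k = k → ε k = false := by
    unfold IsDerB
    refine forall_congr' fun k => ?_
    rw [aVal_wd, letterW_wd, sv_pos, (sv_inj ε).ne_iff]
    cases ε k <;> simp
  have he : excB (wd σ ε) = (univ.filter fun i => sv ε i < sv ε (σ i)).card +
      (univ.filter fun i => ε i = false ∧ σ i = i).card := by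
    unfold excB
    rw [← Finset.card_union_of_disjoint]
    · congr 1
      ext k
      simp only [mem_filter, mem_univ, true_and, mem_union, aVal_wd, letterW_wd, sv_neg,
        (sv_inj ε).eq_iff]
    · rw [Finset.disjoint_left]
      intro k hk hk'
      simp only [mem_filter, mem_univ, true_and] at hk hk'
      rw [hk'.2] at hk
      exact lt_irrefl _ hk
  by_cases h : IsDerB (wd σ ε)
  · rw [if_pos h, he, pow_add]
    congr 1
    rw [hd] at h
    have h1 : (univ.filter fun i => ε i = false ∧ σ i = i) = univ.filter fun i => σ i = i := by
      ext k
      simp only [mem_filter, mem_univ, true_and]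
      exact ⟨fun hk => hk.2, fun hk => ⟨h k hk, hk⟩⟩
    rw [h1, ← prod_const]
    refine prod_congr rfl fun k hk => ?_
    have := h k (by simpa using hk)
    simp [this]
  · rw [if_neg h]
    rw [hd] at h
    push Not at h
    obtain ⟨k, hk, hk2⟩ := h
    rw [Finset.prod_eq_zero (i := k) (by simpa using hk) (by simp at hk2; simp [hk2]), mul_zero]

theorem dB_eq_sum (n : ℕ) : dB n = ∑ ε : Fin n → Bool, ∑ σ : Equiv.Perm (Fin n),
      (X : ℝ[X]) ^ (univ.filter fun i => sv ε i < sv ε (σ i)).card *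
        ∏ i ∈ univ.filter (fun i => σ i = i), (if ε i then 0 else X) := by
  unfold dB
  rw [← Finset.filter_filter, Finset.sum_filter, ← Fintype.sum_prod_type']
  symm
  refine Finset.sum_bij (fun p _ => wd p.2 p.1) ?_ ?_ ?_ ?_
  · rintro ⟨ε, σ⟩ _
    simp only [mem_filter, mem_univ, true_and]
    exact σ.bijective
  · rintro ⟨ε, σ⟩ _ ⟨ε', σ'⟩ _ h
    have h1 : σ = σ' := by
      ext i
      have := congrFun h i
      simp only [wd, Prod.mk.injEq] at this
      rw [this.1]
    subst h1
    have h2 : ε = ε' := by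
      ext k
      have := congrFun h (σ.symm k)
      simp only [wd, Prod.mk.injEq, Equiv.apply_symm_apply] at this
      rw [this.2]
    rw [h2]
  · intro u hu
    have hu : IsSP u := by simpa using hu
    refine ⟨(fun k => (u ((Equiv.ofBijective _ hu).symm k)).2, Equiv.ofBijective _ hu), mem_univ _, ?_⟩
    funext i
    unfold wd
    simp only [Equiv.symm_apply_apply]
    rfl
  · rintro ⟨ε, σ⟩ _
    exact (weight_wd σ ε).symm

theorem sum_eps (n : ℕ) (F : Finset (Fin n)) :
    ∑ ε : Fin n → Bool, ∏ i ∈ F, (if ε i then (0 : ℝ[X]) else X) = X ^ F.card * 2 ^ (n - F.card) := by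
  have h1 : ∀ ε : Fin n → Bool, ∏ i ∈ F, (if ε i then (0 : ℝ[X]) else X) =
      ∏ i, (if i ∈ F then (if ε i then (0 : ℝ[X]) else X) else 1) := by
    intro ε
    rw [Finset.prod_ite_mem]; simp
  simp only [h1]
  have h2 := Finset.prod_univ_sum (fun _ : Fin n => (univ : Finset Bool))
    (fun i b => if i ∈ F then (if b then (0 : ℝ[X]) else X) else 1)
  rw [Fintype.piFinset_univ] at h2
  rw [← h2]
  have h3 : ∀ i : Fin n, ∑ b : Bool, (if i ∈ F then (if b then (0 : ℝ[X]) else X) else 1) =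
      if i ∈ F then X else 2 := by
    intro i
    by_cases hi : i ∈ F <;> simp [hi]
  simp only [h3]
  rw [Finset.prod_ite]
  simp [Finset.filter_not, Finset.card_sdiff]

theorem dB_eq (n : ℕ) : dB n =
    ∑ ij ∈ antidiagonal n, (n.choose ij.1 : ℝ[X]) * (X ^ ij.1 * (2 ^ ij.2 * dA ij.2)) := by
  rw [dB_eq_sum]
  simp only [removal (sv _) (sv_inj _)]
  rw [sum_comm]
  simp only [← sum_mul, sum_eps, Fintype.card_fin]
  rw [sum_finset_card n (fun k => X ^ k * 2 ^ (n - k) * dA (n - k))]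
  refine sum_congr rfl fun ij hij => ?_
  have : ij.1 + ij.2 = n := by simpa using hij
  rw [show n - ij.1 = ij.2 by omega]
  ring

/-! ### Palindromicity -/

theorem reflect_sum' {ι : Type*} (s : Finset ι) (f : ι → ℝ[X]) (N : ℕ) :
    reflect N (∑ i ∈ s, f i) = ∑ i ∈ s, reflect N (f i) := by
  classical
  induction s using Finset.induction_on with
  | empty => simp
  | insert a s ha ih => rw [sum_insert ha, sum_insert ha, reflect_add, ih]

theorem excA_le {n : ℕ} (w : Equiv.Perm (Fin n)) : excA w ≤ n := by
  unfold excA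
  exact (card_le_univ _).trans (by simp)

theorem excA_inv {n : ℕ} (w : Equiv.Perm (Fin n)) (hw : ∀ i, w i ≠ i) :
    excA w + excA w⁻¹ = n := by
  have h : excA w⁻¹ = (univ.filter fun i : Fin n => ¬ i < w i).card := by
    unfold excA
    symm
    refine Finset.card_equiv w fun i => ?_
    rw [mem_filter, mem_filter]
    have hi : w⁻¹ (w i) = i := w.symm_apply_apply i
    simp only [mem_univ, true_and, hi, not_lt]
    exact ⟨fun h => lt_of_le_of_ne h (hw i), le_of_lt⟩
  rw [h]
  unfold excA
  rw [Finset.card_filter_add_card_filter_not]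
  simp

theorem dA_reflect (n : ℕ) : reflect n (dA n) = dA n := by
  unfold dA
  rw [reflect_sum']
  refine Finset.sum_equiv (Equiv.inv _) ?_ ?_
  · intro w
    simp only [mem_filter, mem_univ, true_and, Equiv.inv_apply]
    refine w.forall_congr fun i => ?_
    simp [eq_comm]
  · intro w hw
    simp only [mem_filter, mem_univ, true_and] at hw
    rw [reflect_monomial, revAt_le (excA_le w), Equiv.inv_apply]
    congr 1
    have := excA_inv w hw
    omega

theorem dA_deg (n : ℕ) : (dA n).natDegree ≤ n := by
  unfold dA
  refine natDegree_sum_le_of_forall_le _ _ fun w _ => ?_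
  exact (natDegree_X_pow_le _).trans (excA_le w)

/-- the reflected type B polynomial -/
noncomputable def Rr (n : ℕ) : ℝ[X] :=
  ∑ ij ∈ antidiagonal n, (n.choose ij.1 : ℝ[X]) * (2 ^ ij.2 * dA ij.2)

theorem dB_reflect (n : ℕ) : reflect n (dB n) = Rr n := by
  rw [dB_eq, reflect_sum', Rr]
  refine sum_congr rfl fun ij hij => ?_
  have hn : ij.1 + ij.2 = n := by simpa using hij
  have h : (n.choose ij.1 : ℝ[X]) * (X ^ ij.1 * (2 ^ ij.2 * dA ij.2)) =
      C ((n.choose ij.1 : ℝ) * 2 ^ ij.2) * (X ^ ij.1 * dA ij.2) := by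
    simp only [map_mul, map_pow, map_natCast, map_ofNat]; ring
  rw [h, reflect_C_mul, ← hn, reflect_mul _ _ (natDegree_X_pow_le _) (dA_deg _), dA_reflect,
    reflect_monomial, revAt_le le_rfl]
  simp only [map_mul, map_pow, map_natCast, map_ofNat, Nat.sub_self, pow_zero]
  ring

theorem reflect_succ (n : ℕ) (p : ℝ[X]) (hp : p.natDegree ≤ n) :
    reflect (n+1) p = X * reflect n p := by
  have := reflect_mul (1 : ℝ[X]) p (F := 1) (G := n) (by simp) hp
  rw [one_mul, reflect_one, pow_one, add_comm] at this
  exact this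

theorem reflect_self (n : ℕ) (p : ℝ[X])
    (h : ∀ k ≤ n, p.coeff k = p.coeff (n - k)) : reflect n p = p := by
  ext k
  rw [coeff_reflect]
  by_cases hk : k ≤ n
  · rw [revAt_le hk, ← h k hk]
  · rw [revAt_eq_self_of_lt (by omega)]

theorem fp_key (n : ℕ) (fp fm : ℝ[X])
    (hsum : dB n = fp + fm)
    (hpdeg : fp.degree ≤ (n : WithBot ℕ))
    (hpsymm : ∀ k ≤ n, fp.coeff k = fp.coeff (n - k))
    (hmsymm : ∀ k ≤ n + 1, fm.coeff k = fm.coeff (n + 1 - k)) :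
    (1 - X) * fp = dB n - X * Rr n := by
  have h1 := natDegree_le_of_degree_le hpdeg
  have hd : (dB n).natDegree ≤ n := by
    rw [dB_eq]
    refine natDegree_sum_le_of_forall_le _ _ fun ij hij => ?_
    have hn : ij.1 + ij.2 = n := by simpa using hij
    have h : (n.choose ij.1 : ℝ[X]) * (X ^ ij.1 * (2 ^ ij.2 * dA ij.2)) =
      C ((n.choose ij.1 : ℝ) * 2 ^ ij.2) * (X ^ ij.1 * dA ij.2) := by
      simp only [map_mul, map_pow, map_natCast, map_ofNat]; ring
    rw [h, ← hn]
    refine (natDegree_C_mul_le _ _).trans (natDegree_mul_le.trans ?_)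
    exact add_le_add (natDegree_X_pow_le _) (dA_deg _)
  have h3 : reflect (n+1) (dB n) = reflect (n+1) fp + reflect (n+1) fm := by
    rw [hsum, reflect_add]
  rw [reflect_succ n _ hd, reflect_succ n _ h1, reflect_self n fp hpsymm,
    reflect_self (n+1) fm hmsymm, dB_reflect] at h3
  linear_combination -hsum + h3

/-! ### Exponential generating functions -/

/-- exponential generating function -/
noncomputable def egf (g : ℕ → ℝ[X]) : PowerSeries ℝ[X] :=
  PowerSeries.mk fun n => C ((n.factorial : ℝ)⁻¹) * g n

theorem coeff_egf (g : ℕ → ℝ[X]) (n : ℕ) :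
    PowerSeries.coeff n (egf g) = C ((n.factorial : ℝ)⁻¹) * g n := by
  simp [egf]

theorem egf_mul (g h : ℕ → ℝ[X]) : egf g * egf h =
    egf (fun n => ∑ ij ∈ antidiagonal n, (n.choose ij.1 : ℝ[X]) * (g ij.1 * h ij.2)) := by
  ext1 n
  rw [PowerSeries.coeff_mul, coeff_egf, mul_sum]
  refine sum_congr rfl fun ij hij => ?_
  have hn : ij.1 + ij.2 = n := by simpa using hij
  rw [coeff_egf, coeff_egf]
  have h1 : ((ij.1.factorial : ℝ)⁻¹) * ((ij.2.factorial : ℝ)⁻¹) =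
      ((n.factorial : ℝ)⁻¹) * (n.choose ij.1 : ℝ) := by
    have h2 := Nat.add_choose_mul_factorial_mul_factorial ij.1 ij.2
    rw [hn, ← Nat.choose_symm_of_eq_add hn.symm] at h2
    have h3 : ((n.choose ij.1 : ℕ) : ℝ) * ij.1.factorial * ij.2.factorial = n.factorial := by
      exact_mod_cast h2
    have := Nat.factorial_pos n
    have := Nat.factorial_pos ij.1
    have := Nat.factorial_pos ij.2
    field_simp
    linarith
  have h4 := congrArg (C : ℝ → ℝ[X]) h1
  rw [map_mul, map_mul, map_natCast] at h4
  linear_combination (g ij.1 * h ij.2) * h4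

/-- exponential series -/
noncomputable def Ex (c : ℝ[X]) : PowerSeries ℝ[X] := egf fun n => c ^ n

theorem Ex_mul (c d : ℝ[X]) : Ex c * Ex d = Ex (c + d) := by
  unfold Ex
  rw [egf_mul]
  congr 1
  funext n
  rw [(Commute.all c d).add_pow']
  simp [nsmul_eq_mul]

theorem egf_smul_add (c d : ℝ[X]) (g : ℕ → ℝ[X]) :
    egf (fun n => c * g n + if n = 0 then d else 0) = PowerSeries.C c * egf g + PowerSeries.C d := by
  ext1 n
  rw [map_add, PowerSeries.coeff_C_mul, coeff_egf, coeff_egf, PowerSeries.coeff_C]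
  rcases n with _ | n
  · simp
  · simp; ring

theorem egf_As : Ex (X - 1) * egf As = PowerSeries.C X * egf As + PowerSeries.C (1 - X) := by
  unfold Ex
  rw [egf_mul, ← egf_smul_add]
  congr 1
  funext n
  exact As_rec n

theorem egf_Pe : Ex (X - 1) * egf Pe = PowerSeries.C X * egf Pe + PowerSeries.C (1 - X) := by
  unfold Ex
  rw [egf_mul, ← egf_smul_add]
  congr 1
  funext n
  exact Pe_rec n

theorem egf_Pe_dA : egf Pe = Ex 1 * egf dA := by
  unfold Ex
  rw [egf_mul]
  congr 1
  funext n
  rw [Pe_eq]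
  simp

theorem D_eq : egf dA * (Ex X - PowerSeries.C X * Ex 1) = PowerSeries.C (1 - X) := by
  have h := egf_Pe
  rw [egf_Pe_dA] at h
  have h2 : Ex 1 * Ex (X - 1) = Ex X := by rw [Ex_mul]; congr 1; ring
  linear_combination h - egf dA * h2

theorem egf_Apoly : egf Apoly = egf As - 1 := by
  ext1 n
  rw [map_sub, coeff_egf, coeff_egf, PowerSeries.coeff_one]
  rcases n with _ | n
  · have h2 : ∀ w : Equiv.Perm (Fin 0), desA w = 0 := fun w => by simp [desA]
    simp [Apoly, As, h2]
  · simp [Apoly, As]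

theorem A_eq : egf Apoly * (Ex X - PowerSeries.C X * Ex 1) = Ex 1 - Ex X := by
  have h := egf_As
  have h2 : Ex 1 * Ex (X - 1) = Ex X := by rw [Ex_mul]; congr 1; ring
  rw [egf_Apoly]
  rw [map_sub, map_one] at h
  linear_combination Ex 1 * h - egf As * h2

/-- `D(2t)` -/
noncomputable def D2 : PowerSeries ℝ[X] := egf fun n => 2 ^ n * dA n

theorem rescale_egf (g : ℕ → ℝ[X]) :
    PowerSeries.rescale (2 : ℝ[X]) (egf g) = egf fun n => 2 ^ n * g n := by
  ext1 n
  rw [PowerSeries.coeff_rescale, coeff_egf, coeff_egf]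
  ring

theorem rescale_Ex (c : ℝ[X]) : PowerSeries.rescale (2 : ℝ[X]) (Ex c) = Ex c * Ex c := by
  rw [Ex_mul, Ex, rescale_egf, Ex]
  congr 1
  funext n
  rw [← mul_pow, two_mul]

theorem rescale_C' (c : ℝ[X]) :
    PowerSeries.rescale (2 : ℝ[X]) (PowerSeries.C c) = PowerSeries.C c := by
  ext1 n
  rw [PowerSeries.coeff_rescale, PowerSeries.coeff_C]
  rcases n with _ | n <;> simp

theorem D2_eq : D2 * (Ex X * Ex X - PowerSeries.C X * (Ex 1 * Ex 1)) = PowerSeries.C (1 - X) := by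
  have h := congrArg (PowerSeries.rescale (2 : ℝ[X])) D_eq
  rw [map_mul, map_sub, map_mul, rescale_Ex, rescale_Ex, rescale_C', rescale_C', rescale_egf] at h
  exact h

theorem egf_dB : egf dB = Ex X * D2 := by
  unfold Ex D2
  rw [egf_mul]
  congr 1
  funext n
  exact dB_eq n

theorem egf_Rr : egf Rr = Ex 1 * D2 := by
  unfold Ex D2
  rw [egf_mul]
  congr 1
  funext n
  simp [Rr]

theorem constantCoeff_Ex (c : ℝ[X]) : PowerSeries.constantCoeff (Ex c) = 1 := by
  rw [← PowerSeries.coeff_zero_eq_constantCoeff_apply, Ex, coeff_egf]; simp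

theorem one_sub_X_ne : (1 - X : ℝ[X]) ≠ 0 := by
  intro h
  have := congrArg (eval 0) h
  simp at this

theorem G_eq : (egf dB - PowerSeries.C X * egf Rr) * (1 - PowerSeries.C X * egf Apoly ^ 2) =
    PowerSeries.C (1 - X) * egf dA := by
  have hE : (Ex X - PowerSeries.C X * Ex 1) ≠ 0 := by
    intro h
    have := congrArg PowerSeries.constantCoeff h
    simp only [map_sub, map_mul, constantCoeff_Ex, PowerSeries.constantCoeff_C, map_zero, mul_one] at this
    exact one_sub_X_ne this
  have hE2 : (Ex X * Ex X - PowerSeries.C X * (Ex 1 * Ex 1)) ≠ 0 := by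
    intro h
    have := congrArg PowerSeries.constantCoeff h
    simp only [map_sub, map_mul, constantCoeff_Ex, PowerSeries.constantCoeff_C, map_zero, mul_one] at this
    exact one_sub_X_ne this
  apply mul_right_cancel₀ hE
  apply mul_right_cancel₀ hE2
  rw [egf_dB, egf_Rr]
  have hA := A_eq
  have hD := D_eq
  have hD2 := D2_eq
  generalize egf Apoly = A at *
  generalize egf dA = D at *
  generalize D2 = D2 at *
  generalize Ex X = b at *
  generalize Ex 1 = a at *
  rw [map_sub, map_one] at *
  generalize (PowerSeries.C (X : ℝ[X])) = x at *
  have e1 : (b - x * a) ^ 2 * (1 - x * A ^ 2) = (1 - x) * (b * b - x * (a * a)) := by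
    linear_combination (-x * (A * (b - x * a) + (a - b))) * hA
  linear_combination ((b - x * a) ^ 2 * (1 - x * A ^ 2)) * hD2 + (1 - x) * e1 - (1 - x) * (b * b - x * (a * a)) * hD

theorem coeff_prod_egf (m n : ℕ) (g : Fin m → ℕ → ℝ[X]) :
    ∑ r ∈ Finset.Nat.antidiagonalTuple m n,
      (Nat.multinomial Finset.univ r : ℝ[X]) * ∏ i, g i (r i) =
    C (n.factorial : ℝ) * PowerSeries.coeff n (∏ i, egf (g i)) := by
  rw [PowerSeries.coeff_prod, mul_sum]
  symm
  refine Finset.sum_bij (fun l _ => (l : Fin m → ℕ)) ?_ ?_ ?_ ?_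
  · intro l hl
    rw [Finset.mem_finsuppAntidiag] at hl
    rw [Finset.Nat.mem_antidiagonalTuple]
    exact hl.1
  · intro l _ l' _ h
    exact DFunLike.coe_injective h
  · intro r hr
    rw [Finset.Nat.mem_antidiagonalTuple] at hr
    refine ⟨Finsupp.equivFunOnFinite.symm r, ?_, ?_⟩
    · rw [Finset.mem_finsuppAntidiag]
      exact ⟨hr, by simp⟩
    · rfl
  · intro l hl
    rw [Finset.mem_finsuppAntidiag] at hl
    simp only [coeff_egf, prod_mul_distrib]
    rw [← mul_assoc]
    congr 1
    have h := Nat.multinomial_spec univ (l : Fin m → ℕ)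
    rw [hl.1] at h
    rw [← map_prod, ← map_mul, ← map_natCast (C : ℝ →+* ℝ[X])]
    congr 1
    rw [← h]
    push_cast
    rw [prod_inv_distrib]
    have : (∏ i, ((l i).factorial : ℝ)) ≠ 0 :=
      Finset.prod_ne_zero_iff.2 fun i _ => by exact_mod_cast Nat.factorial_ne_zero _
    field_simp

/-- the right-hand side as a coefficient -/
theorem rhs_eq (n k : ℕ) :
    ∑ r ∈ Finset.Nat.antidiagonalTuple (2 * k + 1) n,
        (Nat.multinomial Finset.univ r : Polynomial ℝ) * X ^ k *
          dA (r 0) * ∏ i : Fin (2 * k), Apoly (r i.succ) =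
    C (n.factorial : ℝ) * PowerSeries.coeff n
      (egf dA * (PowerSeries.C X * egf Apoly ^ 2) ^ k) := by
  have h := coeff_prod_egf (2 * k + 1) n (Fin.cons dA fun _ => Apoly)
  simp only [Fin.prod_univ_succ, Fin.cons_zero, Fin.cons_succ, prod_const, card_univ,
    Fintype.card_fin] at h
  have h2 : egf dA * (PowerSeries.C X * egf Apoly ^ 2) ^ k =
      PowerSeries.C (X ^ k) * (egf dA * egf Apoly ^ (2 * k)) := by
    rw [map_pow, pow_mul]; ring
  rw [h2, PowerSeries.coeff_C_mul, mul_left_comm, ← h, mul_sum]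
  refine sum_congr rfl fun r _ => ?_
  ring

theorem series_key (n : ℕ) :
    C (n.factorial : ℝ) * (((1 - X) : ℝ[X]) * ∑ k ∈ range (n+1), PowerSeries.coeff n
      (egf dA * (PowerSeries.C X * egf Apoly ^ 2) ^ k)) = dB n - X * Rr n := by
  set q : PowerSeries ℝ[X] := PowerSeries.C X * egf Apoly ^ 2 with hq
  set S : PowerSeries ℝ[X] := ∑ k ∈ range (n+1), egf dA * q ^ k with hS
  set G := egf dB - PowerSeries.C X * egf Rr with hG
  have hGq : G * (1 - q) = PowerSeries.C (1 - X) * egf dA := G_eq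
  have hgeom : S * (1 - q) = egf dA * (1 - q ^ (n+1)) := by
    rw [hS, ← mul_sum, mul_assoc, geom_sum_mul_neg]
  have hA0 : PowerSeries.constantCoeff (egf Apoly) = 0 := by
    rw [← PowerSeries.coeff_zero_eq_constantCoeff_apply, coeff_egf]; simp [Apoly]
  have hq0 : PowerSeries.constantCoeff q = 0 := by
    rw [hq]; simp [hA0]
  have hdvd : (PowerSeries.X : PowerSeries ℝ[X]) ^ (n+1) ∣ q ^ (n+1) :=
    pow_dvd_pow_of_dvd (PowerSeries.X_dvd_iff.2 hq0) _
  have hu : IsUnit (1 - q) := by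
    rw [PowerSeries.isUnit_iff_constantCoeff]; simp [hq0]
  have hdiff : (PowerSeries.X : PowerSeries ℝ[X]) ^ (n+1) ∣ (G - PowerSeries.C (1 - X) * S) := by
    rw [← hu.dvd_mul_right]
    have : (G - PowerSeries.C (1 - X) * S) * (1 - q) = q ^ (n+1) * (PowerSeries.C (1 - X) * egf dA) := by
      linear_combination hGq - PowerSeries.C (1 - X) * hgeom
    rw [this]
    exact hdvd.mul_right _
  have hc := (PowerSeries.X_pow_dvd_iff.1 hdiff) n (Nat.lt_succ_self n)
  rw [hG, map_sub, map_sub, PowerSeries.coeff_C_mul, PowerSeries.coeff_C_mul, coeff_egf, coeff_egf,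
    hS, map_sum] at hc
  have hf : C (n.factorial : ℝ) * C ((n.factorial : ℝ)⁻¹) = (1 : ℝ[X]) := by
    rw [← map_mul, mul_inv_cancel₀ (by exact_mod_cast Nat.factorial_ne_zero _), map_one]
  linear_combination (dB n - X * Rr n) * hf - C (n.factorial : ℝ) * hc

end FP

/-- `f_n^+`, the symmetric part of `d_n^B` with center of symmetry `n/2`
(characterized by: `d_n^B = f_n^+ + f_n^-`, `deg f_n^+ ≤ n`, `f_n^+(x) = x^n f_n^+(1/x)`,
`deg f_n^- ≤ n+1`, `f_n^-(x) = x^{n+1} f_n^-(1/x)`), equals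
`Σ (n choose r_0,…,r_{2k}) x^k d_{r_0}(x) A_{r_1}(x) ⋯ A_{r_{2k}}(x)`,
summed over all `k ∈ ℕ` and sequences of nonnegative integers summing to `n`
(convention `A_0 = 0`; all terms with `k > n` vanish). -/
theorem fplus_eq_multinomial_sum (n : ℕ)
    (fp fm : Polynomial ℝ)
    (hsum : dB n = fp + fm)
    (hpdeg : fp.degree ≤ (n : WithBot ℕ))
    (hpsymm : ∀ k ≤ n, fp.coeff k = fp.coeff (n - k))
    (hmdeg : fm.degree ≤ ((n + 1 : ℕ) : WithBot ℕ))
    (hmsymm : ∀ k ≤ n + 1, fm.coeff k = fm.coeff (n + 1 - k))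
    :
    fp = ∑ k ∈ Finset.range (n + 1),
      ∑ r ∈ Finset.Nat.antidiagonalTuple (2 * k + 1) n,
        (Nat.multinomial Finset.univ r : Polynomial ℝ) * X ^ k *
          dA (r 0) * ∏ i : Fin (2 * k), Apoly (r i.succ) := by
  have h1 := FP.fp_key n fp fm hsum hpdeg hpsymm hmsymm
  rw [← FP.series_key] at h1
  apply mul_left_cancel₀ FP.one_sub_X_ne
  rw [h1]
  simp only [FP.rhs_eq]
  rw [← mul_sum]
  ring
end

section
/- For every natural number n there exist nonnegative integers ξ^+_{n,i} for 0 ≤ i ≤ ⌊n/2⌋ and nonnegative integers ξ^-_{n,i} for 0 ≤ i ≤ ⌊(n+1)/2⌋ such that f_n^+(x) = Σ_{i=0}^{⌊n/2⌋} ξ^+_{n,i} x^i (1+x)^{n−2i} and f_n^-(x) = Σ_{i=0}^{⌊(n+1)/2⌋} ξ^-_{n,i} x^i (1+x)^{n+1−2i}. In particular, f_n^+(x) and f_n^-(x) have nonnegative, symmetric and unimodal coefficient sequences with centers of symmetry n/2 and (n+1)/2, respectively. -/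
open Polynomial Finset

/-- generators of the γ-cone -/
def gamGen (n c : ℕ) : Set (Polynomial ℝ) :=
  {p | ∃ i, c ≤ i ∧ 2 * i ≤ n ∧ p = X ^ i * (1 + X) ^ (n - 2 * i)}

/-- the γ-cone: `c = 1` demands no `i = 0` term -/
noncomputable def gam (n c : ℕ) : AddSubmonoid (Polynomial ℝ) := AddSubmonoid.closure (gamGen n c)

lemma gam_gen {n c i : ℕ} (h : c ≤ i) (h2 : 2 * i ≤ n) : X ^ i * (1 + X) ^ (n - 2 * i) ∈ gam n c :=
  AddSubmonoid.subset_closure ⟨i, h, h2, rfl⟩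

lemma gam_mul_nat {n c : ℕ} {p : Polynomial ℝ} (k : ℕ) (h : p ∈ gam n c) :
    (k : Polynomial ℝ) * p ∈ gam n c := by
  rw [← nsmul_eq_mul]; exact AddSubmonoid.nsmul_mem _ h k

lemma gam_mono {n c : ℕ} {p : Polynomial ℝ} (h : p ∈ gam n c) : p ∈ gam n 0 := by
  refine AddSubmonoid.closure_mono ?_ h
  rintro q ⟨i, _, h2, rfl⟩
  exact ⟨i, Nat.zero_le _, h2, rfl⟩

lemma gam_X_mul {n c : ℕ} {p : Polynomial ℝ} (hc : c ≤ 1) (h : p ∈ gam n 0) :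
    X * p ∈ gam (n + 2) c := by
  induction h using AddSubmonoid.closure_induction with
  | mem q hq =>
    obtain ⟨i, _, h2, rfl⟩ := hq
    have := @gam_gen (n + 2) c (i + 1) (by omega) (by omega)
    rw [show n + 2 - 2 * (i + 1) = n - 2 * i by omega] at this
    convert this using 1
    ring
  | zero => simp
  | add a b _ _ ha hb => rw [mul_add]; exact add_mem ha hb

lemma gam_opP {n : ℕ} {p : Polynomial ℝ} (h : p ∈ gam n 0) :
    2 * (n : Polynomial ℝ) * X * p + 2 * X * (1 - X) * derivative p ∈ gam (n + 1) 0 := by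
  induction h using AddSubmonoid.closure_induction with
  | mem q hq =>
    obtain ⟨i, _, h2, rfl⟩ := hq
    obtain ⟨m, rfl⟩ := Nat.exists_eq_add_of_le h2
    have h1 := gam_mul_nat (2 * i) (@gam_gen (2 * i + m + 1) 0 i (by omega) (by omega))
    rw [show 2 * i + m + 1 - 2 * i = m + 1 by omega] at h1
    rw [show 2 * i + m - 2 * i = m by omega]
    rcases m with _ | m
    · convert h1 using 1
      rcases i with _ | i
      · simp
      · simp; ring
    · have h3 := gam_mul_nat (4 * (m + 1)) (@gam_gen (2 * i + (m + 1) + 1) 0 (i + 1) (by omega) (by omega))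
      rw [show 2 * i + (m + 1) + 1 - 2 * (i + 1) = m by omega] at h3
      convert add_mem h1 h3 using 1
      rcases i with _ | i
      · simp [derivative_pow]; ring
      · simp [derivative_pow]; ring
  | zero => simp
  | add a b _ _ ha hb =>
    convert add_mem ha hb using 1
    rw [derivative_add]; ring

lemma gam_opM {n : ℕ} {p : Polynomial ℝ} (h : p ∈ gam n 1) :
    2 * (n : Polynomial ℝ) * X * p + 2 * X * (1 - X) * derivative p - (1 + X) * p ∈ gam (n + 1) 1 := by
  induction h using AddSubmonoid.closure_induction with
  | mem q hq =>
    obtain ⟨i, hi, h2, rfl⟩ := hq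
    obtain ⟨m, rfl⟩ := Nat.exists_eq_add_of_le h2
    obtain ⟨i, rfl⟩ := Nat.exists_eq_add_of_le' hi
    have h1 := gam_mul_nat (2 * i + 1) (@gam_gen (2 * (i + 1) + m + 1) 1 (i + 1) (by omega) (by omega))
    rw [show 2 * (i + 1) + m + 1 - 2 * (i + 1) = m + 1 by omega] at h1
    rw [show 2 * (i + 1) + m - 2 * (i + 1) = m by omega]
    rcases m with _ | m
    · convert h1 using 1
      simp; ring
    · have h3 := gam_mul_nat (4 * (m + 1)) (@gam_gen (2 * (i + 1) + (m + 1) + 1) 1 (i + 1 + 1) (by omega) (by omega))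
      rw [show 2 * (i + 1) + (m + 1) + 1 - 2 * (i + 1 + 1) = m by omega] at h3
      convert add_mem h1 h3 using 1
      simp [derivative_pow]; ring
  | zero => simp
  | add a b _ _ ha hb =>
    convert add_mem ha hb using 1
    rw [derivative_add]; ring

/-- existence of the integer γ-vector -/
lemma gam_exists {n : ℕ} {p : Polynomial ℝ} (h : p ∈ gam n 0) :
    ∃ xp : ℕ → ℕ, p = ∑ i ∈ Finset.range (n / 2 + 1),
        (xp i : Polynomial ℝ) * X ^ i * (1 + X) ^ (n - 2 * i) := by
  induction h using AddSubmonoid.closure_induction with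
  | mem q hq =>
    obtain ⟨i, _, h2, rfl⟩ := hq
    refine ⟨fun j => if j = i then 1 else 0, ?_⟩
    rw [Finset.sum_eq_single i]
    · simp
    · intro b _ hb; simp [hb]
    · intro hi; exact absurd (Finset.mem_range.2 (by omega)) hi
  | zero => exact ⟨fun _ => 0, by simp⟩
  | add a b _ _ ha hb =>
    obtain ⟨x, hx⟩ := ha
    obtain ⟨y, hy⟩ := hb
    refine ⟨fun i => x i + y i, ?_⟩
    rw [hx, hy, ← Finset.sum_add_distrib]
    refine Finset.sum_congr rfl fun i _ => ?_
    push_cast; ring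

lemma gen_coeff (i m k : ℕ) : (X ^ i * (1 + X) ^ m : Polynomial ℝ).coeff k =
    if i ≤ k then (m.choose (k - i) : ℝ) else 0 := by
  rw [coeff_X_pow_mul']
  split_ifs with h
  · rw [coeff_one_add_X_pow]
  · rfl

lemma choose_step_le {m k : ℕ} (h : 2 * k + 1 ≤ m) : m.choose k ≤ m.choose (k + 1) := by
  have h1 := Nat.choose_succ_right_eq m k
  have : m.choose k * (k + 1) ≤ m.choose (k + 1) * (k + 1) := by
    rw [h1]; exact Nat.mul_le_mul_left _ (by omega)
  exact Nat.le_of_mul_le_mul_right this (by omega)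

lemma choose_step_ge {m k : ℕ} (h : m ≤ 2 * k + 1) : m.choose (k + 1) ≤ m.choose k := by
  have h1 := Nat.choose_succ_right_eq m k
  have : m.choose (k + 1) * (k + 1) ≤ m.choose k * (k + 1) := by
    rw [h1]; exact Nat.mul_le_mul_left _ (by omega)
  exact Nat.le_of_mul_le_mul_right this (by omega)

lemma gam_coeffs {n : ℕ} {p : Polynomial ℝ} (h : p ∈ gam n 0) :
    (∀ k, 0 ≤ p.coeff k) ∧ (∀ k, k + 1 ≤ n / 2 → p.coeff k ≤ p.coeff (k + 1)) ∧
    (∀ k, n / 2 ≤ k → k < n → p.coeff (k + 1) ≤ p.coeff k) ∧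
    (∀ k ≤ n, p.coeff k = p.coeff (n - k)) ∧ (∀ k, n < k → p.coeff k = 0) := by
  induction h using AddSubmonoid.closure_induction with
  | mem q hq =>
    obtain ⟨i, _, h2, rfl⟩ := hq
    obtain ⟨m, rfl⟩ := Nat.exists_eq_add_of_le h2
    rw [show 2 * i + m - 2 * i = m by omega]
    simp only [gen_coeff]
    refine ⟨?_, ?_, ?_, ?_, ?_⟩
    · intro k; split_ifs <;> positivity
    · intro k hk
      by_cases h : i ≤ k
      · rw [if_pos h, if_pos (by omega), show k + 1 - i = k - i + 1 by omega]
        exact_mod_cast choose_step_le (by omega)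
      · rw [if_neg h]; split_ifs <;> positivity
    · intro k hk hk'
      rw [if_pos (by omega), if_pos (by omega), show k + 1 - i = k - i + 1 by omega]
      exact_mod_cast choose_step_ge (by omega)
    · intro k hk
      by_cases h : i ≤ k
      · rw [if_pos h]
        by_cases h' : k ≤ i + m
        · rw [if_pos (by omega), show 2 * i + m - k - i = m - (k - i) by omega,
            Nat.choose_symm (by omega)]
        · rw [if_neg (by omega), Nat.choose_eq_zero_of_lt (by omega)]; simp
      · rw [if_neg h, if_pos (by omega), Nat.choose_eq_zero_of_lt (by omega)]; simp
    · intro k hk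
      rw [if_pos (by omega), Nat.choose_eq_zero_of_lt (by omega)]; simp
  | zero => simp
  | add a b _ _ ha hb =>
    obtain ⟨a1, a2, a3, a4, a5⟩ := ha
    obtain ⟨b1, b2, b3, b4, b5⟩ := hb
    simp only [coeff_add]
    exact ⟨fun k => add_nonneg (a1 k) (b1 k), fun k h => add_le_add (a2 k h) (b2 k h),
      fun k h h' => add_le_add (a3 k h h') (b3 k h h'),
      fun k h => by rw [a4 k h, b4 k h], fun k h => by rw [a5 k h, b5 k h, add_zero]⟩

/-- existence of the decomposition, from the recurrence -/
lemma exists_decomp (d : ℕ → Polynomial ℝ) (h0 : d 0 = 1) (h1 : d 1 = X)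
    (hrec : ∀ n : ℕ, d (n + 2) = (2 * (n : Polynomial ℝ) + 3) * X * d (n + 1)
      + 2 * X * (1 - X) * derivative (d (n + 1)) + 2 * ((n : Polynomial ℝ) + 1) * X * d n) (n : ℕ) :
    ∃ P M P' M', d n = P + M ∧ P ∈ gam n 0 ∧ M ∈ gam (n + 1) 1 ∧
      d (n + 1) = P' + M' ∧ P' ∈ gam (n + 1) 0 ∧ M' ∈ gam (n + 2) 1 := by
  induction n with
  | zero =>
    refine ⟨1, 0, 0, X, by simp [h0], ?_, zero_mem _, by simp [h1], zero_mem _, ?_⟩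
    · simpa using @gam_gen 0 0 0 le_rfl le_rfl
    · simpa using @gam_gen 2 1 1 le_rfl le_rfl
  | succ n ih =>
    obtain ⟨P, M, P', M', hd, hP, hM, hd', hP', hM'⟩ := ih
    refine ⟨P', M',
      (2 * ((n + 1 : ℕ) : Polynomial ℝ) * X * P' + 2 * X * (1 - X) * derivative P')
        + ((2 * (n + 1) : ℕ) : Polynomial ℝ) * (X * P) + M',
      (2 * ((n + 2 : ℕ) : Polynomial ℝ) * X * M' + 2 * X * (1 - X) * derivative M' - (1 + X) * M')
        + X * P' + ((2 * (n + 1) : ℕ) : Polynomial ℝ) * (X * M), hd', hP', hM', ?_, ?_, ?_⟩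
    · rw [hrec, hd, hd', derivative_add]; push_cast; ring
    · exact add_mem (add_mem (gam_opP hP') (gam_mul_nat _ (gam_X_mul (by omega) hP))) (gam_mono hM')
    · exact add_mem (add_mem (gam_opM hM') (gam_X_mul le_rfl hP'))
        (gam_mul_nat _ (gam_X_mul le_rfl (gam_mono hM)))

/-- the main theorem for any sequence satisfying the recurrence -/
lemma decomp_unique (n : ℕ) (P M fp fm : Polynomial ℝ) (hsum : P + M = fp + fm)
    (hpdeg : fp.degree ≤ (n : WithBot ℕ))
    (hpsymm : ∀ k ≤ n, fp.coeff k = fp.coeff (n - k))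
    (hmsymm : ∀ k ≤ n + 1, fm.coeff k = fm.coeff (n + 1 - k))
    (hP : P ∈ gam n 0) (hM : M ∈ gam (n + 1) 0) : fp = P ∧ fm = M := by
  obtain ⟨-, -, -, p4, p5⟩ := gam_coeffs hP
  obtain ⟨-, -, -, m4, m5⟩ := gam_coeffs hM
  have hg : ∀ k, fp.coeff k - P.coeff k = M.coeff k - fm.coeff k := by
    intro k
    have := congrArg (fun q => Polynomial.coeff q k) hsum
    simp only [coeff_add] at this
    linarith
  have hz : ∀ k, n < k → fp.coeff k = 0 := fun k hk =>
    coeff_eq_zero_of_degree_lt (lt_of_le_of_lt hpdeg (by exact_mod_cast hk))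
  have key : ∀ k, k ≤ n + 1 → fp.coeff k - P.coeff k = 0 := by
    intro k
    induction k with
    | zero =>
      intro h
      rw [hg, m4 0 h, hmsymm 0 h, ← hg, hz _ (by omega), p5 _ (by omega), sub_zero]
    | succ k ih =>
      intro h
      rw [hg, m4 _ h, hmsymm _ h, ← hg, show n + 1 - (k + 1) = n - k by omega,
        ← p4 k (by omega), ← hpsymm k (by omega)]
      exact ih (by omega)
  have e : fp = P := by
    ext k
    by_cases h : k ≤ n + 1
    · linarith [key k h]
    · rw [hz _ (by omega), p5 _ (by omega)]
  refine ⟨e, ?_⟩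
  rw [e] at hsum
  exact (add_left_cancel hsum).symm

open Equiv in
lemma perm_sum_option {R α : Type*} [CommRing R] [Fintype α] [DecidableEq α]
    (w : Option α → Option α → R) :
    ∑ σ : Perm (Option α), ∏ k, w k (σ k) =
      w none none * ∑ σ : Perm α, ∏ k, w (some k) (some (σ k)) +
      ∑ σ : Perm α, ∑ j, w none (some (σ j)) * w (some j) none *
        ∏ k ∈ univ.erase j, w (some k) (some (σ k)) := by
  rw [← Equiv.sum_comp (Perm.decomposeOption (α := α)).symm, Fintype.sum_prod_type,
    Fintype.sum_option]
  congr 1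
  · rw [Finset.mul_sum]
    refine Finset.sum_congr rfl fun σ _ => ?_
    rw [Fintype.prod_option]
    simp
  · rw [Finset.sum_comm]
    refine Finset.sum_congr rfl fun σ _ => ?_
    rw [← Equiv.sum_comp σ]
    refine Finset.sum_congr rfl fun j _ => ?_
    rw [Fintype.prod_option, ← Finset.mul_prod_erase univ _ (Finset.mem_univ j), mul_assoc]
    have h1 : (Perm.decomposeOption.symm (some (σ j), σ)) none = some (σ j) := by
      simp [Perm.decomposeOption]
    have h2 : (Perm.decomposeOption.symm (some (σ j), σ)) (some j) = none := by
      simp [Perm.decomposeOption]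
    rw [h1, h2]
    congr 2
    refine Finset.prod_congr rfl fun k hk => ?_
    have hk' : k ≠ j := Finset.ne_of_mem_erase hk
    have h3 : (Perm.decomposeOption.symm (some (σ j), σ)) (some k) = some (σ k) := by
      simp only [Perm.decomposeOption, Equiv.coe_fn_symm_mk, Perm.mul_apply,
        Equiv.optionCongr_apply, Option.map_some]
      exact swap_apply_of_ne_of_ne (by simp) (by simpa using hk')
    rw [h3]

open Equiv in
lemma perm_sum_fix_option {R α : Type*} [CommRing R] [Fintype α] [DecidableEq α]
    (w : Option α → Option α → R) :
    ∑ σ : Perm (Option α), (if σ none = none then ∏ k ∈ univ.erase none, w k (σ k) else 0) =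
      ∑ σ : Perm α, ∏ k, w (some k) (some (σ k)) := by
  rw [← Equiv.sum_comp (Perm.decomposeOption (α := α)).symm, Fintype.sum_prod_type,
    Fintype.sum_option]
  rw [Finset.sum_eq_zero (s := (univ : Finset α)), add_zero]
  · refine Finset.sum_congr rfl fun σ _ => ?_
    rw [if_pos (by simp)]
    have : (univ : Finset (Option α)).erase none = univ.map Function.Embedding.some := by
      ext x; cases x <;> simp
    rw [this, Finset.prod_map]
    simp
  · intro i _
    refine Finset.sum_eq_zero fun σ _ => ?_
    rw [if_neg (by simp [Perm.decomposeOption])]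

open Equiv in
lemma perm_sum_fin {R : Type*} [CommRing R] {n : ℕ} (w : Fin (n + 1) → Fin (n + 1) → R) :
    ∑ σ : Perm (Fin (n + 1)), ∏ k, w k (σ k) =
      w (Fin.last n) (Fin.last n) * ∑ σ : Perm (Fin n), ∏ k, w k.castSucc (σ k).castSucc +
      ∑ σ : Perm (Fin n), ∑ j, w (Fin.last n) (σ j).castSucc * w j.castSucc (Fin.last n) *
        ∏ k ∈ univ.erase j, w k.castSucc (σ k).castSucc := by
  have h := perm_sum_option (fun a b : Option (Fin n) =>
    w ((finSuccEquiv' (Fin.last n)).symm a) ((finSuccEquiv' (Fin.last n)).symm b))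
  simp only [finSuccEquiv'_symm_none, finSuccEquiv'_symm_some, Fin.succAbove_last] at h
  rw [← h, ← Equiv.sum_comp (finSuccEquiv' (Fin.last n)).symm.permCongr]
  refine Finset.sum_congr rfl fun σ _ => ?_
  rw [← Equiv.prod_comp (finSuccEquiv' (Fin.last n)).symm]
  simp [Equiv.permCongr_apply]

open Equiv in
lemma perm_sum_fix_fin {R : Type*} [CommRing R] {n : ℕ} (w : Fin (n + 1) → Fin (n + 1) → R)
    (j : Fin (n + 1)) :
    ∑ σ : Perm (Fin (n + 1)), (if σ j = j then ∏ k ∈ univ.erase j, w k (σ k) else 0) =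
      ∑ σ : Perm (Fin n), ∏ k, w (j.succAbove k) (j.succAbove (σ k)) := by
  have h := perm_sum_fix_option (fun a b : Option (Fin n) =>
    w ((finSuccEquiv' j).symm a) ((finSuccEquiv' j).symm b))
  simp only [finSuccEquiv'_symm_some] at h
  rw [← h, ← Equiv.sum_comp (finSuccEquiv' j).symm.permCongr]
  refine Finset.sum_congr rfl fun σ _ => ?_
  have hc : (((finSuccEquiv' j).symm.permCongr σ) j = j) ↔ (σ none = none) := by
    rw [Equiv.permCongr_apply, Equiv.symm_symm, finSuccEquiv'_at, Equiv.symm_apply_eq,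
      finSuccEquiv'_at]
  simp only [hc]
  split_ifs with hh
  · symm
    refine Finset.prod_bij (fun a _ => (finSuccEquiv' j).symm a) ?_ ?_ ?_ ?_
    · intro a ha
      simp only [Finset.mem_erase, Finset.mem_univ, and_true] at ha ⊢
      rw [Ne, Equiv.symm_apply_eq, finSuccEquiv'_at]; exact ha
    · intro a _ b _ hab; exact (finSuccEquiv' j).symm.injective hab
    · intro b hb
      refine ⟨finSuccEquiv' j b, ?_, by simp⟩
      simp only [Finset.mem_erase, Finset.mem_univ, and_true] at hb ⊢
      rw [Ne, finSuccEquiv'_eq_none]; exact fun h => hb h.symm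
    · intro a _; simp [Equiv.permCongr_apply]
  · rfl

/-- weight of `a ↦ b` for the sign vector `s` -/
noncomputable def wtS {n : ℕ} (s : Fin n → Bool) (a b : Fin n) : Polynomial ℝ :=
  if a = b ∧ s a = true then 0
  else if (s a = true ∧ s b = true ∧ a < b) ∨ (s a = false ∧ (s b = true ∨ b ≤ a)) then X else 1

/-- sum over the signed permutations with a given sign vector -/
noncomputable def wsum {n : ℕ} (s : Fin n → Bool) : Polynomial ℝ :=
  ∑ σ : Equiv.Perm (Fin n), ∏ k, wtS s k (σ k)

lemma wtS_key {n : ℕ} (s : Fin n → Bool) (a b : Fin n) :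
    1 = (1 - X) * derivative (wtS s a b) + wtS s a b + (if b = a ∧ s a = true then 1 else 0) := by
  unfold wtS
  by_cases h : a = b ∧ s a = true
  · rw [if_pos h, if_pos ⟨h.1.symm, h.2⟩]; simp
  · rw [if_neg h, if_neg (show ¬ (b = a ∧ s a = true) from fun h' => h ⟨h'.1.symm, h'.2⟩)]
    split_ifs <;> simp

lemma wtS_emb {m n : ℕ} (s : Fin n → Bool) (f : Fin m ↪o Fin n) (a b : Fin m) :
    wtS s (f a) (f b) = wtS (s ∘ f) a b := by
  simp [wtS]

lemma sum_erase_key {n : ℕ} (s : Fin n → Bool) (σ : Equiv.Perm (Fin n)) :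
    ∑ j, ∏ k ∈ univ.erase j, wtS s k (σ k) =
      (1 - X) * derivative (∏ k, wtS s k (σ k)) + (n : Polynomial ℝ) * ∏ k, wtS s k (σ k) +
      ∑ j, if s j = true then
        (if σ j = j then ∏ k ∈ univ.erase j, wtS s k (σ k) else 0) else 0 := by
  have h1 : ∀ j, ∏ k ∈ univ.erase j, wtS s k (σ k) =
      (1 - X) * ((∏ k ∈ univ.erase j, wtS s k (σ k)) * derivative (wtS s j (σ j)))
      + ∏ k, wtS s k (σ k) +
      (if s j = true then
        (if σ j = j then ∏ k ∈ univ.erase j, wtS s k (σ k) else 0) else 0) := by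
    intro j
    rw [← Finset.mul_prod_erase univ (fun k => wtS s k (σ k)) (Finset.mem_univ j)]
    have h := congrArg (fun q => q * ∏ k ∈ univ.erase j, wtS s k (σ k)) (wtS_key s j (σ j))
    simp only [one_mul] at h
    refine h.trans ?_
    by_cases h1 : s j = true <;> by_cases h2 : σ j = j <;> simp [h1, h2] <;> ring
  rw [Finset.sum_congr rfl fun j _ => h1 j, Finset.sum_add_distrib, Finset.sum_add_distrib,
    ← Finset.mul_sum, derivative_prod_finset]
  simp

lemma wsum_snoc {n : ℕ} (s : Fin n → Bool) (c : Bool) :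
    wsum (Fin.snoc s c : Fin (n + 1) → Bool) = (if c then 0 else X) * wsum s +
      X * ((1 - X) * derivative (wsum s) + (n : Polynomial ℝ) * wsum s +
        ∑ j, if s j = true then
          ∑ σ : Equiv.Perm (Fin n),
            (if σ j = j then ∏ k ∈ univ.erase j, wtS s k (σ k) else 0) else 0) := by
  unfold wsum
  rw [perm_sum_fin]
  have hcc : ∀ a b : Fin n, wtS (Fin.snoc s c : Fin (n + 1) → Bool) a.castSucc b.castSucc
      = wtS s a b := by
    intro a b; simp [wtS]
  have hll : wtS (Fin.snoc s c : Fin (n + 1) → Bool) (Fin.last n) (Fin.last n)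
      = if c then 0 else X := by
    cases c <;> simp [wtS]
  have hm : ∀ a b : Fin n, wtS (Fin.snoc s c : Fin (n + 1) → Bool) (Fin.last n) b.castSucc *
      wtS (Fin.snoc s c : Fin (n + 1) → Bool) a.castSucc (Fin.last n) = X := by
    intro a b
    have h1 : Fin.last n ≠ b.castSucc := (Fin.castSucc_lt_last b).ne'
    have h2 : a.castSucc ≠ Fin.last n := (Fin.castSucc_lt_last a).ne
    have h3 := Fin.castSucc_lt_last a
    have h4 := (Fin.castSucc_lt_last b)
    cases c <;> cases ha : s a <;> cases hb : s b <;>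
      simp [wtS, h1, h2, h3, h4, h3.not_ge, h4.not_gt, h4.le, ha, hb]
  simp only [hcc, hll, hm]
  congr 1
  simp only [← Finset.mul_sum]
  congr 1
  rw [Finset.sum_congr rfl fun σ _ => sum_erase_key s σ, Finset.sum_add_distrib,
    Finset.sum_add_distrib, ← Finset.mul_sum, ← Finset.mul_sum, derivative_sum]
  congr 1
  rw [Finset.sum_comm]
  refine Finset.sum_congr rfl fun j _ => ?_
  split_ifs <;> simp

/-- sum over all sign vectors -/
noncomputable def tot (n : ℕ) : Polynomial ℝ := ∑ s : Fin n → Bool, wsum s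

lemma tot_zero : tot 0 = 1 := by simp [tot, wsum]

lemma tot_succ (n : ℕ) : tot (n + 1) = X * tot n +
      2 * X * ((1 - X) * derivative (tot n) + (n : Polynomial ℝ) * tot n +
        ∑ s : Fin n → Bool, ∑ j, if s j = true then
          ∑ σ : Equiv.Perm (Fin n),
            (if σ j = j then ∏ k ∈ univ.erase j, wtS s k (σ k) else 0) else 0) := by
  unfold tot
  rw [← Equiv.sum_comp (Fin.snocEquiv (fun _ : Fin (n + 1) => Bool)), Fintype.sum_prod_type]
  have : ∀ (c : Bool) (s : Fin n → Bool), wsum ((Fin.snocEquiv (fun _ : Fin (n + 1) => Bool)) (c, s))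
    = wsum (Fin.snoc s c : Fin (n + 1) → Bool) := fun _ _ => rfl
  simp only [this, wsum_snoc, Finset.sum_add_distrib, ← Finset.mul_sum, Fintype.sum_bool,
    derivative_sum]
  simp
  ring

lemma tot_one : tot 1 = X := by
  rw [tot_succ, tot_zero]; simp

lemma tot_third (n : ℕ) : (∑ s : Fin (n + 1) → Bool, ∑ j, if s j = true then
          ∑ σ : Equiv.Perm (Fin (n + 1)),
            (if σ j = j then ∏ k ∈ univ.erase j, wtS s k (σ k) else 0) else 0)
      = ((n : Polynomial ℝ) + 1) * tot n := by
  rw [Finset.sum_comm]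
  have : ∀ j : Fin (n + 1), (∑ s : Fin (n + 1) → Bool, if s j = true then
          ∑ σ : Equiv.Perm (Fin (n + 1)),
            (if σ j = j then ∏ k ∈ univ.erase j, wtS s k (σ k) else 0) else 0) = tot n := by
    intro j
    simp only [perm_sum_fix_fin]
    rw [← Equiv.sum_comp (Fin.insertNthEquiv (fun _ : Fin (n + 1) => Bool) j),
      Fintype.sum_prod_type, Fintype.sum_bool]
    simp only [Fin.insertNthEquiv_apply, Fin.insertNth_apply_same]
    simp only [if_true, Bool.false_eq_true, if_false, Finset.sum_const_zero, add_zero]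
    unfold tot wsum
    refine Finset.sum_congr rfl fun s _ => Finset.sum_congr rfl fun σ _ =>
      Finset.prod_congr rfl fun k _ => ?_
    have := wtS_emb (j.insertNth true s : Fin (n + 1) → Bool) (Fin.succAboveOrderEmb j) k (σ k)
    simp only [Fin.succAboveOrderEmb_apply] at this
    refine Eq.trans this ?_
    congr 1
    ext i
    simp
  rw [Finset.sum_congr rfl fun j _ => this j]
  simp

lemma tot_rec (n : ℕ) : tot (n + 2) = (2 * (n : Polynomial ℝ) + 3) * X * tot (n + 1)
      + 2 * X * (1 - X) * derivative (tot (n + 1)) + 2 * ((n : Polynomial ℝ) + 1) * X * tot n := by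
  rw [tot_succ, tot_third]; push_cast; ring

/-- the word of a signed permutation -/
def wordOf {n : ℕ} (σ : Equiv.Perm (Fin n)) (s : Fin n → Bool) : Fin n → Fin n × Bool :=
  fun j => (σ j, s (σ j))

lemma aVal_wordOf {n : ℕ} (σ : Equiv.Perm (Fin n)) (s : Fin n → Bool) (k : Fin n) :
    aVal (wordOf σ s) k = if s k then ((k : ℤ) + 1) else -((k : ℤ) + 1) := by
  unfold aVal
  have : (∃ j, wordOf σ s j = (k, true)) ↔ s k = true := by
    constructor
    · rintro ⟨j, hj⟩
      simp only [wordOf, Prod.mk.injEq] at hj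
      rw [← hj.1]; exact hj.2
    · intro h
      exact ⟨σ.symm k, by simp [wordOf, h]⟩
  simp only [this]

lemma letterW_wordOf {n : ℕ} (σ : Equiv.Perm (Fin n)) (s : Fin n → Bool) (k : Fin n) :
    letterW (wordOf σ s) k = if s (σ k) then ((σ k : ℤ) + 1) else -((σ k : ℤ) + 1) := rfl

lemma prod_wordOf {n : ℕ} (σ : Equiv.Perm (Fin n)) (s : Fin n → Bool) :
    (if IsDerB (wordOf σ s) then (X : Polynomial ℝ) ^ excB (wordOf σ s) else 0) =
      ∏ k, wtS s k (σ k) := by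
  split_ifs with h
  · unfold excB
    rw [Finset.card_filter, ← Finset.prod_pow_eq_pow_sum]
    refine Finset.prod_congr rfl fun k _ => ?_
    have hk := h k
    rw [aVal_wordOf, letterW_wordOf] at hk ⊢
    unfold wtS
    have hne : ¬ (k = σ k ∧ s k = true) := by
      rintro ⟨h1, h2⟩
      rw [← h1, h2] at hk
      simp only [if_true] at hk
      exact hk (by positivity) rfl
    rw [if_neg hne]
    · have : ((if s k = true then (k : ℤ) + 1 else -((k : ℤ) + 1)) <
          (if s (σ k) = true then (σ k : ℤ) + 1 else -((σ k : ℤ) + 1)) ∨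
          (if s k = true then (k : ℤ) + 1 else -((k : ℤ) + 1)) < 0 ∧
          (if s (σ k) = true then (σ k : ℤ) + 1 else -((σ k : ℤ) + 1)) =
          (if s k = true then (k : ℤ) + 1 else -((k : ℤ) + 1))) ↔
          ((s k = true ∧ s (σ k) = true ∧ k < σ k) ∨
            (s k = false ∧ (s (σ k) = true ∨ σ k ≤ k))) := by
        rw [Fin.lt_def, Fin.le_def]
        cases h1 : s k <;> cases h2 : s (σ k) <;> simp <;> omega
      simp only [this]
      split_ifs <;> simp
  · unfold IsDerB at h
    push Not at h
    obtain ⟨k, hk, hk'⟩ := h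
    rw [letterW_wordOf, aVal_wordOf] at hk'
    rw [aVal_wordOf] at hk
    symm
    refine Finset.prod_eq_zero (Finset.mem_univ k) ?_
    have hs : s k = true := by
      by_contra hs
      rw [if_neg hs] at hk
      omega
    have hσ : k = σ k := by
      rw [hs] at hk'
      apply Fin.ext
      split_ifs at hk' <;> omega
    unfold wtS
    rw [if_pos ⟨hσ, hs⟩]

lemma dB_eq_tot (n : ℕ) : dB n = tot n := by
  unfold dB tot wsum
  rw [← Finset.filter_filter, Finset.sum_filter]
  rw [← Fintype.sum_prod_type' (f := fun (s : Fin n → Bool) (σ : Equiv.Perm (Fin n)) =>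
    ∏ k, wtS s k (σ k))]
  symm
  refine Finset.sum_bij (fun a _ => wordOf a.2 a.1) ?_ ?_ ?_ ?_
  · intro a _
    simp only [Finset.mem_filter, Finset.mem_univ, true_and]
    exact a.2.bijective
  · rintro ⟨s, σ⟩ _ ⟨t, τ⟩ _ h
    have h1 : σ = τ := by
      ext j
      exact congrArg (fun u : Fin n × Bool => (u.1 : ℕ)) (congrFun h j)
    subst h1
    have h2 : s = t := by
      ext j
      have := congrArg Prod.snd (congrFun h (σ.symm j))
      simpa [wordOf] using this
    rw [h2]
  · intro u hu
    simp only [Finset.mem_filter, Finset.mem_univ, true_and] at hu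
    refine ⟨(fun k => (u ((Equiv.ofBijective _ hu).symm k)).2, Equiv.ofBijective _ hu),
      Finset.mem_univ _, ?_⟩
    funext j
    simp only [wordOf, Equiv.symm_apply_apply]
    rfl
  · intro a _
    exact (prod_wordOf a.2 a.1).symm

/-- `f_n^+` and `f_n^-` are γ-nonnegative: there are nonnegative integers `ξ⁺_{n,i}`,
`ξ⁻_{n,i}` with `f_n^+ = Σ_{i ≤ ⌊n/2⌋} ξ⁺_{n,i} x^i (1+x)^{n-2i}` and
`f_n^- = Σ_{i ≤ ⌊(n+1)/2⌋} ξ⁻_{n,i} x^i (1+x)^{n+1-2i}`.  In particular both have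
nonnegative and unimodal coefficients, with peaks at `⌊n/2⌋` and `⌊(n+1)/2⌋`. -/
theorem fplus_fminus_gamma_nonneg (n : ℕ)
    (fp fm : Polynomial ℝ)
    (hsum : dB n = fp + fm)
    (hpdeg : fp.degree ≤ (n : WithBot ℕ))
    (hpsymm : ∀ k ≤ n, fp.coeff k = fp.coeff (n - k))
    (hmdeg : fm.degree ≤ ((n + 1 : ℕ) : WithBot ℕ))
    (hmsymm : ∀ k ≤ n + 1, fm.coeff k = fm.coeff (n + 1 - k))
    :
    (∃ xp : ℕ → ℕ, fp = ∑ i ∈ Finset.range (n / 2 + 1),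
        (xp i : Polynomial ℝ) * X ^ i * (1 + X) ^ (n - 2 * i)) ∧
    (∃ xm : ℕ → ℕ, fm = ∑ i ∈ Finset.range ((n + 1) / 2 + 1),
        (xm i : Polynomial ℝ) * X ^ i * (1 + X) ^ (n + 1 - 2 * i)) ∧
    (∀ k, 0 ≤ fp.coeff k) ∧ (∀ k, 0 ≤ fm.coeff k) ∧
    (∀ k, k + 1 ≤ n / 2 → fp.coeff k ≤ fp.coeff (k + 1)) ∧
    (∀ k, n / 2 ≤ k → k < n → fp.coeff (k + 1) ≤ fp.coeff k) ∧
    (∀ k, k + 1 ≤ (n + 1) / 2 → fm.coeff k ≤ fm.coeff (k + 1)) ∧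
    (∀ k, (n + 1) / 2 ≤ k → k < n + 1 → fm.coeff (k + 1) ≤ fm.coeff k) := by
  obtain ⟨P, M, -, -, hd, hP, hM, -⟩ := exists_decomp tot tot_zero tot_one tot_rec n
  have hM' := gam_mono hM
  obtain ⟨rfl, rfl⟩ := decomp_unique n P M fp fm (by rw [← hd, ← dB_eq_tot, hsum])
    hpdeg hpsymm hmsymm hP hM'
  obtain ⟨p1, p2, p3, -, -⟩ := gam_coeffs hP
  obtain ⟨m1, m2, m3, -, -⟩ := gam_coeffs hM'
  exact ⟨gam_exists hP, gam_exists hM', p1, m1, p2, p3, m2, m3⟩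
end

section
/- For every natural number n, writing d_n^B(x) = Σ_{k=0}^n d^B_{n,k} x^k, the coefficient sequence of d_n^B(x) is unimodal with a peak at ⌊(n+1)/2⌋; that is, d^B_{n,k} ≤ d^B_{n,k+1} for 0 ≤ k < ⌊(n+1)/2⌋ and d^B_{n,k} ≥ d^B_{n,k+1} for ⌊(n+1)/2⌋ ≤ k < n. -/
open Polynomial Finset

namespace DBUni

def val {n : ℕ} (ε : Fin n → Bool) (i : Fin n) : ℤ :=
  if ε i then ((i : ℤ) + 1) else -((i : ℤ) + 1)

def isE {n : ℕ} (ε : Fin n → Bool) (σ : Equiv.Perm (Fin n)) (i : Fin n) : Prop :=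
  val ε i < val ε (σ i) ∨ (ε i = false ∧ σ i = i)

instance {n : ℕ} (ε : Fin n → Bool) (σ : Equiv.Perm (Fin n)) (i : Fin n) :
    Decidable (isE ε σ i) := by unfold isE; infer_instance

def E {n : ℕ} (ε : Fin n → Bool) (σ : Equiv.Perm (Fin n)) : ℕ :=
  ∑ i, if isE ε σ i then 1 else 0

def Der {n : ℕ} (ε : Fin n → Bool) (σ : Equiv.Perm (Fin n)) : Prop :=
  ∀ i, ¬ (ε i = true ∧ σ i = i)

/-- all points except possibly `j` are not positive fixed points -/
def DerOff {n : ℕ} (ε : Fin n → Bool) (σ : Equiv.Perm (Fin n)) (j : Fin n) : Prop :=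
  ∀ i, i ≠ j → ¬ (ε i = true ∧ σ i = i)

open Classical in
noncomputable def S (n : ℕ) (g : ℕ → ℝ) : ℝ :=
  ∑ ε : Fin n → Bool, ∑ σ : Equiv.Perm (Fin n), if Der ε σ then g (E ε σ) else 0

/-- insertion of the point `p` -/
def ins {n : ℕ} (p : Fin (n + 1)) (o : Option (Fin n)) (σ : Equiv.Perm (Fin n)) :
    Equiv.Perm (Fin (n + 1)) :=
  Equiv.permCongr (finSuccEquiv' p).symm (Equiv.Perm.decomposeOption.symm (o, σ))

lemma ins_none_p {n : ℕ} (p : Fin (n + 1)) (σ : Equiv.Perm (Fin n)) : ins p none σ p = p := by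
  simp [ins, Equiv.permCongr_apply]

lemma ins_none {n : ℕ} (p : Fin (n + 1)) (σ : Equiv.Perm (Fin n)) (k : Fin n) :
    ins p none σ (p.succAbove k) = p.succAbove (σ k) := by
  simp [ins, Equiv.permCongr_apply]

lemma ins_some_p {n : ℕ} (p : Fin (n + 1)) (i : Fin n) (σ : Equiv.Perm (Fin n)) :
    ins p (some i) σ p = p.succAbove i := by
  simp [ins, Equiv.permCongr_apply]

lemma ins_some_eq {n : ℕ} (p : Fin (n + 1)) (σ : Equiv.Perm (Fin n)) (j : Fin n) :
    ins p (some (σ j)) σ (p.succAbove j) = p := by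
  simp [ins, Equiv.permCongr_apply]

lemma ins_some_ne {n : ℕ} (p : Fin (n + 1)) (σ : Equiv.Perm (Fin n)) (j k : Fin n) (h : k ≠ j) :
    ins p (some (σ j)) σ (p.succAbove k) = p.succAbove (σ k) := by
  have : σ k ≠ σ j := fun h' => h (σ.injective h')
  simp [ins, Equiv.permCongr_apply, Equiv.swap_apply_of_ne_of_ne, this]

lemma sum_ins {n : ℕ} (p : Fin (n + 1)) (F : Equiv.Perm (Fin (n + 1)) → ℝ) :
    ∑ σ, F σ = ∑ σ : Equiv.Perm (Fin n), (F (ins p none σ) + ∑ j, F (ins p (some (σ j)) σ)) := by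
  rw [← Equiv.sum_comp ((Equiv.Perm.decomposeOption (α := Fin n)).symm.trans
    (Equiv.permCongr (finSuccEquiv' p).symm)) F, Fintype.sum_prod_type_right]
  refine Finset.sum_congr rfl fun σ _ => ?_
  rw [Fintype.sum_option]
  congr 1
  rw [← Equiv.sum_comp σ]
  rfl

lemma sum_eps {n : ℕ} (p : Fin (n + 1)) (F : (Fin (n + 1) → Bool) → ℝ) :
    ∑ ε, F ε = ∑ ε : Fin n → Bool, ∑ b : Bool, F (p.insertNth b ε) := by
  rw [← Equiv.sum_comp (Fin.insertNthEquiv (fun _ => Bool) p) F, Fintype.sum_prod_type_right]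
  rfl

lemma val_lt {n : ℕ} (p : Fin (n + 1)) (b : Bool) (ε : Fin n → Bool) (i j : Fin n) :
    val (p.insertNth b ε : Fin (n + 1) → Bool) (p.succAbove i) <
      val (p.insertNth b ε : Fin (n + 1) → Bool) (p.succAbove j) ↔ val ε i < val ε j := by
  have h1 : p.succAbove i < p.succAbove j ↔ i < j := Fin.succAbove_lt_succAbove_iff
  have h2 : p.succAbove j < p.succAbove i ↔ j < i := Fin.succAbove_lt_succAbove_iff
  simp only [Fin.lt_def] at h1 h2
  simp only [val, Fin.insertNth_apply_succAbove]
  split_ifs <;> omega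

lemma isE_lift {n : ℕ} (p : Fin (n + 1)) (b : Bool) (ε : Fin n → Bool)
    (σ : Equiv.Perm (Fin n)) (τ : Equiv.Perm (Fin (n + 1))) (k : Fin n)
    (h : τ (p.succAbove k) = p.succAbove (σ k)) :
    isE (p.insertNth b ε : Fin (n + 1) → Bool) τ (p.succAbove k) ↔ isE ε σ k := by
  unfold isE
  rw [h, val_lt]
  simp

lemma fix_lift {n : ℕ} (p : Fin (n + 1)) (b : Bool) (ε : Fin n → Bool)
    (σ : Equiv.Perm (Fin n)) (τ : Equiv.Perm (Fin (n + 1))) (k : Fin n)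
    (h : τ (p.succAbove k) = p.succAbove (σ k)) :
    ((p.insertNth b ε : Fin (n + 1) → Bool) (p.succAbove k) = true ∧
      τ (p.succAbove k) = p.succAbove k) ↔ (ε k = true ∧ σ k = k) := by
  rw [h]; simp

lemma E_none {n : ℕ} (p : Fin (n + 1)) (b : Bool) (ε : Fin n → Bool) (σ : Equiv.Perm (Fin n)) :
    E (p.insertNth b ε : Fin (n + 1) → Bool) (ins p none σ) = E ε σ + if b then 0 else 1 := by
  unfold E
  rw [Fin.sum_univ_succAbove _ p, add_comm]
  congr 1
  · refine Finset.sum_congr rfl fun k _ => ?_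
    simp only [isE_lift p b ε σ _ k (ins_none p σ k)]
  · cases b <;> simp [isE, ins_none_p]

lemma Der_none {n : ℕ} (p : Fin (n + 1)) (b : Bool) (ε : Fin n → Bool) (σ : Equiv.Perm (Fin n)) :
    Der (p.insertNth b ε : Fin (n + 1) → Bool) (ins p none σ) ↔ b = false ∧ Der ε σ := by
  unfold Der
  rw [Fin.forall_iff_succAbove p]
  simp only [fix_lift p b ε σ _ _ (ins_none p σ _)]
  simp [ins_none_p]

lemma DerOff_none {n : ℕ} (p : Fin (n + 1)) (b : Bool) (ε : Fin n → Bool)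
    (σ : Equiv.Perm (Fin n)) :
    DerOff (p.insertNth b ε : Fin (n + 1) → Bool) (ins p none σ) p ↔ Der ε σ := by
  unfold Der DerOff
  rw [Fin.forall_iff_succAbove p]
  simp only [fix_lift p b ε σ _ _ (ins_none p σ _)]
  simp

lemma Der_some {n : ℕ} (p : Fin (n + 1)) (b : Bool) (ε : Fin n → Bool) (σ : Equiv.Perm (Fin n))
    (j : Fin n) :
    Der (p.insertNth b ε : Fin (n + 1) → Bool) (ins p (some (σ j)) σ) ↔ DerOff ε σ j := by
  unfold Der DerOff
  rw [Fin.forall_iff_succAbove p]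
  constructor
  · rintro ⟨-, h⟩ k hk
    have := h k
    rwa [fix_lift p b ε σ _ _ (ins_some_ne p σ j k hk)] at this
  · intro h
    refine ⟨by simp [ins_some_p], fun k => ?_⟩
    by_cases hk : k = j
    · subst hk; simp [ins_some_eq]
    · rw [fix_lift p b ε σ _ _ (ins_some_ne p σ j k hk)]
      exact h k hk

lemma E_some {n : ℕ} (b : Bool) (ε : Fin n → Bool) (σ : Equiv.Perm (Fin n)) (j : Fin n) :
    E ((Fin.last n).insertNth b ε : Fin (n + 1) → Bool) (ins (Fin.last n) (some (σ j)) σ)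
      + (if isE ε σ j then 1 else 0) = E ε σ + 1 := by
  unfold E
  rw [Fin.sum_univ_succAbove _ (Fin.last n), ← Finset.add_sum_erase _ _ (Finset.mem_univ j),
    ← Finset.add_sum_erase univ (fun i => if isE ε σ i then 1 else 0) (Finset.mem_univ j)]
  have h1 : ∑ k ∈ univ.erase j, (if isE ((Fin.last n).insertNth b ε : Fin (n + 1) → Bool)
      (ins (Fin.last n) (some (σ j)) σ) ((Fin.last n).succAbove k) then 1 else 0) =
      ∑ k ∈ univ.erase j, if isE ε σ k then 1 else 0 := by
    refine Finset.sum_congr rfl fun k hk => ?_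
    simp only [isE_lift (Fin.last n) b ε σ _ k
      (ins_some_ne (Fin.last n) σ j k (Finset.ne_of_mem_erase hk))]
  rw [h1]
  have e1 : isE ((Fin.last n).insertNth b ε : Fin (n + 1) → Bool)
      (ins (Fin.last n) (some (σ j)) σ) (Fin.last n) ↔ b = false := by
    unfold isE
    rw [ins_some_p]
    simp only [val, Fin.insertNth_apply_succAbove, Fin.insertNth_apply_same,
      Fin.succAbove_last, Fin.val_castSucc, Fin.val_last]
    have := (σ j).isLt
    have h3 : (σ j).castSucc ≠ Fin.last n := (Fin.castSucc_lt_last _).ne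
    simp only [h3, and_false, or_false]
    cases b <;> simp <;> split_ifs <;> omega
  have e2 : isE ((Fin.last n).insertNth b ε : Fin (n + 1) → Bool)
      (ins (Fin.last n) (some (σ j)) σ) ((Fin.last n).succAbove j) ↔ b = true := by
    unfold isE
    rw [ins_some_eq]
    simp only [val, Fin.insertNth_apply_succAbove, Fin.insertNth_apply_same,
      Fin.succAbove_last, Fin.val_castSucc, Fin.val_last]
    have := j.isLt
    have h3 : Fin.last n ≠ j.castSucc := (Fin.castSucc_lt_last _).ne'
    simp only [h3, and_false, or_false]
    cases b <;> simp <;> split_ifs <;> omega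
  simp only [e1, e2]
  cases b <;> simp <;> omega

open Classical in
lemma S_bad {n : ℕ} (p : Fin (n + 1)) (h : ℕ → ℝ) :
    ∑ ε : Fin (n + 1) → Bool, ∑ σ : Equiv.Perm (Fin (n + 1)),
      (if (ε p = true ∧ σ p = p) ∧ DerOff ε σ p then h (E ε σ) else 0) = S n h := by
  unfold S
  rw [sum_eps p]
  refine Finset.sum_congr rfl fun ε _ => ?_
  simp only [Fintype.sum_bool, sum_ins p, Fin.insertNth_apply_same, ins_none_p, ins_some_p,
    DerOff_none, E_none]
  simp

lemma E_le {n : ℕ} (ε : Fin n → Bool) (σ : Equiv.Perm (Fin n)) : E ε σ ≤ n := by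
  unfold E
  calc _ ≤ ∑ i : Fin n, 1 := Finset.sum_le_sum fun i _ => by split_ifs <;> simp
    _ = n := by simp

open Classical in
lemma arc_sum {n : ℕ} (ε : Fin n → Bool) (σ : Equiv.Perm (Fin n)) (g : ℕ → ℝ) :
    ∑ j : Fin n, (if DerOff ε σ j then
      g (E ε σ + 1 - (if isE ε σ j then 1 else 0)) else 0) =
    (if Der ε σ then (E ε σ : ℝ) * g (E ε σ) + ((n : ℝ) - E ε σ) * g (E ε σ + 1) else 0) +
    ∑ j : Fin n, (if (ε j = true ∧ σ j = j) ∧ DerOff ε σ j then g (E ε σ + 1) else 0) := by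
  by_cases hD : Der ε σ
  · have h1 : ∀ j, DerOff ε σ j := fun j i _ => hD i
    have h2 : ∀ j, ¬ ((ε j = true ∧ σ j = j) ∧ DerOff ε σ j) := fun j h => hD j h.1
    rw [Finset.sum_eq_zero (s := univ) (f := fun j => if (ε j = true ∧ σ j = j) ∧ DerOff ε σ j
      then g (E ε σ + 1) else 0) (fun j _ => if_neg (h2 j))]
    simp only [h1, hD, if_true, add_zero]
    have h3 : ∀ j : Fin n, g (E ε σ + 1 - (if isE ε σ j then 1 else 0)) =
        ((if isE ε σ j then 1 else 0 : ℕ) : ℝ) * (g (E ε σ) - g (E ε σ + 1)) + g (E ε σ + 1) := by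
      intro j
      split_ifs <;> simp
    simp only [h3]
    rw [Finset.sum_add_distrib, ← Finset.sum_mul, ← Nat.cast_sum]
    change (E ε σ : ℝ) * _ + _ = _
    simp
    ring
  · simp only [hD, if_false, zero_add]
    refine Finset.sum_congr rfl fun j _ => ?_
    by_cases hj : DerOff ε σ j
    · have hb : ε j = true ∧ σ j = j := by
        by_contra hb
        apply hD
        intro i
        by_cases hi : i = j
        · rw [hi]; exact hb
        · exact hj i hi
      have : ¬ isE ε σ j := by simp [isE, hb]
      simp [hj, hb, this]
    · simp [hj]

lemma S_succ (n : ℕ) (g : ℕ → ℝ) :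
    S (n + 1) g = S n (fun e => 2 * (e : ℝ) * g e + (2 * ((n : ℝ) - e) + 1) * g (e + 1)) +
      2 * n * S (n - 1) (fun e => g (e + 1)) := by
  classical
  have key : S (n + 1) g = ∑ ε : Fin n → Bool, ∑ σ : Equiv.Perm (Fin n),
      ((if Der ε σ then g (E ε σ + 1) else 0) + 2 * ∑ j : Fin n, (if DerOff ε σ j then
      g (E ε σ + 1 - (if isE ε σ j then 1 else 0)) else 0)) := by
    unfold S
    rw [sum_eps (Fin.last n)]
    refine Finset.sum_congr rfl fun ε _ => ?_
    rw [Fintype.sum_bool, sum_ins (Fin.last n), sum_ins (Fin.last n), ← Finset.sum_add_distrib]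
    refine Finset.sum_congr rfl fun σ _ => ?_
    have hE : ∀ (b : Bool) (j : Fin n), E ((Fin.last n).insertNth b ε : Fin (n + 1) → Bool)
        (ins (Fin.last n) (some (σ j)) σ) = E ε σ + 1 - (if isE ε σ j then 1 else 0) := by
      intro b j
      have := E_some b ε σ j
      omega
    simp only [Der_none, Der_some, E_none, hE]
    simp
    ring
  rw [key]
  simp only [arc_sum, mul_add, Finset.sum_add_distrib]
  have hbad : ∑ ε : Fin n → Bool, ∑ σ : Equiv.Perm (Fin n), 2 * ∑ j : Fin n,
      (if (ε j = true ∧ σ j = j) ∧ DerOff ε σ j then g (E ε σ + 1) else 0) =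
      2 * n * S (n - 1) (fun e => g (e + 1)) := by
    cases n with
    | zero => simp
    | succ m =>
      simp only [← Finset.mul_sum]
      rw [mul_assoc]
      congr 1
      calc _ = ∑ j : Fin (m + 1), ∑ ε : Fin (m + 1) → Bool, ∑ σ : Equiv.Perm (Fin (m + 1)),
          (if (ε j = true ∧ σ j = j) ∧ DerOff ε σ j then g (E ε σ + 1) else 0) := by
            conv_rhs => rw [Finset.sum_comm]
            refine Finset.sum_congr rfl fun ε _ => ?_
            conv_rhs => rw [Finset.sum_comm]
        _ = _ := by
            simp only [fun j => S_bad j (fun e => g (e + 1))]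
            simp
  rw [hbad, ← add_assoc]
  congr 1
  unfold S
  simp only [← Finset.sum_add_distrib]
  refine Finset.sum_congr rfl fun ε _ => Finset.sum_congr rfl fun σ _ => ?_
  split_ifs
  · ring
  · simp

noncomputable def a (n k : ℕ) : ℝ := S n (fun e => if e = k then 1 else 0)

lemma a_nonneg (n k : ℕ) : 0 ≤ a n k := by
  unfold a S
  refine Finset.sum_nonneg fun ε _ => Finset.sum_nonneg fun σ _ => ?_
  dsimp only
  split_ifs <;> norm_num

lemma S_mul (n : ℕ) (c : ℝ) (g : ℕ → ℝ) : S n (fun e => c * g e) = c * S n g := by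
  unfold S
  simp only [Finset.mul_sum, mul_ite, mul_zero]

lemma S_add (n : ℕ) (f g : ℕ → ℝ) : S n (fun e => f e + g e) = S n f + S n g := by
  unfold S
  simp only [← Finset.sum_add_distrib]
  refine Finset.sum_congr rfl fun ε _ => Finset.sum_congr rfl fun σ _ => ?_
  split_ifs <;> simp

lemma a_zero (k : ℕ) : a 0 k = if k = 0 then 1 else 0 := by
  rw [eq_comm]
  simp [a, S, Der, E, eq_comm (a := 0) (b := k)]

lemma a_succ_zero (n : ℕ) : a (n + 1) 0 = 0 := by
  unfold a
  rw [S_succ]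
  have h1 : (fun e : ℕ => 2 * (e : ℝ) * (if e = 0 then 1 else 0) +
    (2 * ((n : ℝ) - e) + 1) * (if e + 1 = 0 then 1 else 0)) = fun e => 0 * (0 : ℝ) := by
    funext e
    rcases e with _ | e <;> simp
  have h2 : (fun e : ℕ => (if e + 1 = 0 then 1 else 0 : ℝ)) = fun e => 0 * (0 : ℝ) := by
    funext e; simp
  rw [h1, h2, S_mul n 0 (fun _ => 0), S_mul (n - 1) 0 (fun _ => 0)]
  simp

lemma a_succ (n k : ℕ) : a (n + 1) (k + 1) =
    (2 * ((n : ℝ) - k) + 1) * a n k + 2 * ((k : ℝ) + 1) * a n (k + 1) + 2 * n * a (n - 1) k := by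
  unfold a
  rw [S_succ]
  simp only [add_left_inj]
  congr 1
  rw [← S_mul, ← S_mul, ← S_add]
  congr 1
  funext e
  by_cases h : e = k
  · subst h; simp
  · by_cases h' : e = k + 1
    · subst h'; simp
    · simp [h, h']

lemma a_big (n : ℕ) : ∀ k, n < k → a n k = 0 := by
  intro k hk
  unfold a S
  refine Finset.sum_eq_zero fun ε _ => Finset.sum_eq_zero fun σ _ => ?_
  have := E_le ε σ
  have h : E ε σ ≠ k := by omega
  simp [h]

def P (n : ℕ) : Prop :=
  (∀ j k, j + k = n + 1 → k ≤ j → a n j ≤ a n k) ∧ (∀ j k, j + k = n → k ≤ j → a n k ≤ a n j)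

lemma P_zero : P 0 := by
  constructor
  · intro j k h hk
    rw [a_big 0 j (by omega)]; exact a_nonneg _ _
  · intro j k h hk
    obtain rfl : j = k := by omega
    exact le_rfl

lemma P_step (n : ℕ) (hP : P n) (hQ : P (n - 1)) : P (n + 1) := by
  constructor
  · intro j k h hk
    rcases k with _ | k
    · rw [a_big (n + 1) j (by omega)]; exact a_nonneg _ _
    rcases Nat.eq_or_lt_of_le hk with rfl | hlt
    · exact le_rfl
    obtain ⟨j, rfl⟩ : ∃ i, j = i + 1 := ⟨j - 1, by omega⟩
    rw [a_succ, a_succ]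
    have hn : (n : ℝ) = j + k := by
      have : n = j + k := by omega
      rw [this]; push_cast; ring
    have hjk : (k : ℝ) + 1 ≤ j := by exact_mod_cast (show k + 1 ≤ j by omega)
    have hb : (2 * n : ℝ) * a (n - 1) j ≤ 2 * n * a (n - 1) k := by
      rcases n with _ | m
      · simp
      · exact mul_le_mul_of_nonneg_left (hQ.1 j k (by simp; omega) (by omega)) (by positivity)
    have h1 : a n (j + 1) ≤ a n k := hP.1 _ _ (by omega) (by omega)
    have h2 : a n k ≤ a n j := hP.2 _ _ (by omega) (by omega)
    have h3 : a n j ≤ a n (k + 1) := hP.1 _ _ (by omega) (by omega)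
    have hk0 : (0 : ℝ) ≤ k := by positivity
    rw [hn] at hb ⊢
    nlinarith [mul_le_mul_of_nonneg_left h3 (show (0 : ℝ) ≤ 2 * k + 1 by linarith),
      mul_le_mul_of_nonneg_left h1 (show (0 : ℝ) ≤ 2 * j + 1 by linarith)]
  · intro j k h hk
    rcases k with _ | k
    · rw [a_succ_zero]; exact a_nonneg _ _
    rcases Nat.eq_or_lt_of_le hk with rfl | hlt
    · exact le_rfl
    obtain ⟨j, rfl⟩ : ∃ i, j = i + 1 := ⟨j - 1, by omega⟩
    rw [a_succ, a_succ]
    have hn : (n : ℝ) = j + k + 1 := by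
      have : n = j + k + 1 := by omega
      rw [this]; push_cast; ring
    have hjk : (k : ℝ) + 1 ≤ j := by exact_mod_cast (show k + 1 ≤ j by omega)
    have hb : (2 * n : ℝ) * a (n - 1) k ≤ 2 * n * a (n - 1) j :=
      mul_le_mul_of_nonneg_left (hQ.2 j k (by omega) (by omega)) (by positivity)
    have h1 : a n k ≤ a n (j + 1) := hP.2 _ _ (by omega) (by omega)
    have h2 : a n (j + 1) ≤ a n (k + 1) := hP.1 _ _ (by omega) (by omega)
    have h3 : a n (k + 1) ≤ a n j := hP.2 _ _ (by omega) (by omega)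
    have hk0 : (0 : ℝ) ≤ k := by positivity
    rw [hn] at hb ⊢
    nlinarith [mul_le_mul_of_nonneg_left h3 (show (0 : ℝ) ≤ 2 * k + 2 by linarith),
      mul_le_mul_of_nonneg_left h1 (show (0 : ℝ) ≤ 2 * j + 2 by linarith)]

lemma P_all (n : ℕ) : P n := by
  induction n using Nat.strong_induction_on with
  | _ n ih =>
    rcases n with _ | n
    · exact P_zero
    · exact P_step n (ih n (by omega)) (ih (n - 1) (by omega))

/-- the word of the pair `(ε, σ)` -/
def word {n : ℕ} (q : (Fin n → Bool) × Equiv.Perm (Fin n)) : Fin n → Fin n × Bool :=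
  fun i => (q.2 i, q.1 (q.2 i))

lemma letterW_word {n : ℕ} (q : (Fin n → Bool) × Equiv.Perm (Fin n)) (i : Fin n) :
    letterW (word q) i = val q.1 (q.2 i) := rfl

lemma aVal_word {n : ℕ} (q : (Fin n → Bool) × Equiv.Perm (Fin n)) (i : Fin n) :
    aVal (word q) i = val q.1 i := by
  have : (∃ j, word q j = (i, true)) ↔ q.1 i = true := by
    constructor
    · rintro ⟨j, hj⟩
      simp only [word, Prod.mk.injEq] at hj
      rw [← hj.1]; exact hj.2
    · intro h
      exact ⟨q.2.symm i, by simp [word, h]⟩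
  simp only [aVal, val, this]

lemma val_inj {n : ℕ} (ε : Fin n → Bool) (i j : Fin n) : val ε i = val ε j ↔ i = j := by
  constructor
  · intro h
    unfold val at h
    ext
    split_ifs at h <;> omega
  · rintro rfl; rfl

lemma val_neg {n : ℕ} (ε : Fin n → Bool) (i : Fin n) : val ε i < 0 ↔ ε i = false := by
  unfold val
  split_ifs with h <;> simp [h] <;> omega

lemma val_pos {n : ℕ} (ε : Fin n → Bool) (i : Fin n) : 0 < val ε i ↔ ε i = true := by
  unfold val
  split_ifs with h <;> simp [h] <;> omega

lemma excB_word {n : ℕ} (q : (Fin n → Bool) × Equiv.Perm (Fin n)) :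
    excB (word q) = E q.1 q.2 := by
  unfold excB E
  rw [Finset.card_filter]
  refine Finset.sum_congr rfl fun i _ => ?_
  simp only [letterW_word, aVal_word, val_neg, val_inj, isE]

lemma IsDerB_word {n : ℕ} (q : (Fin n → Bool) × Equiv.Perm (Fin n)) :
    IsDerB (word q) ↔ Der q.1 q.2 := by
  simp only [IsDerB, Der, letterW_word, aVal_word, val_pos, ne_eq, val_inj, not_and]

lemma coeff_dB (n k : ℕ) : (dB n).coeff k = a n k := by
  classical
  unfold dB a S
  rw [← Fintype.sum_prod_type' (f := fun (ε : Fin n → Bool) (σ : Equiv.Perm (Fin n)) =>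
    if Der ε σ then (if E ε σ = k then (1 : ℝ) else 0) else 0), ← Finset.sum_filter,
    Polynomial.finsetSum_coeff]
  symm
  refine Finset.sum_bij (fun q _ => word q) ?_ ?_ ?_ ?_
  · intro q hq
    simp only [mem_filter, mem_univ, true_and] at hq ⊢
    exact ⟨q.2.bijective, (IsDerB_word q).2 hq⟩
  · rintro ⟨ε, σ⟩ _ ⟨ε', σ'⟩ _ h
    have h0 : ∀ i, σ i = σ' i ∧ ε (σ i) = ε' (σ' i) := fun i => by
      simpa [word] using congrFun h i
    obtain rfl : σ = σ' := Equiv.ext fun i => (h0 i).1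
    have : ε = ε' := funext fun i => by simpa using (h0 (σ.symm i)).2
    rw [this]
  · intro u hu
    simp only [mem_filter, mem_univ, true_and] at hu
    let σ : Equiv.Perm (Fin n) := Equiv.ofBijective _ hu.1
    have hσ : ∀ i, σ i = (u i).1 := fun i => rfl
    have hw : word ((fun i => (u (σ.symm i)).2), σ) = u := by
      funext i
      simp only [word, Equiv.symm_apply_apply]
      rw [hσ]
    refine ⟨((fun i => (u (σ.symm i)).2), σ), ?_, hw⟩
    simp only [mem_filter, mem_univ, true_and]
    rw [← hw] at hu
    exact (IsDerB_word _).1 hu.2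
  · intro q _
    rw [excB_word, Polynomial.coeff_X_pow]
    simp only [eq_comm]

end DBUni

/-- The coefficient sequence of `d_n^B(x)` is unimodal with a peak at `⌊(n+1)/2⌋`. -/
theorem dB_unimodal (n : ℕ) :
    (∀ k, k + 1 ≤ (n + 1) / 2 → (dB n).coeff k ≤ (dB n).coeff (k + 1)) ∧
    (∀ k, (n + 1) / 2 ≤ k → k < n → (dB n).coeff (k + 1) ≤ (dB n).coeff k) := by
  simp only [DBUni.coeff_dB]
  obtain ⟨h1, h2⟩ := DBUni.P_all n
  constructor
  · intro k hk
    exact (h2 (n - k) k (by omega) (by omega)).trans (h1 (n - k) (k + 1) (by omega) (by omega))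
  · intro k hk hkn
    exact (h1 (k + 1) (n - k) (by omega) (by omega)).trans (h2 k (n - k) (by omega) (by omega))
end
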